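/- arXiv:1007.3007 — 4 statements merged into one kernel-verified Lean document; each statement's English description precedes it below -/
import Mathlib

section
/- Let N ≤ 3 and let B = (β_ij) be a symmetric n×n real matrix with β_ii ≥ 0 for every i = 1,…,n. If B is NOT strictly copositive, then the system −Δu_i = ∑_{j=1}^n β_ij u_j² u_i (i = 1,…,n) admits a nontrivial solution on ℝ^N, i.e. there exist twice continuously differentiable functions u₁,…,uₙ : ℝ^N → ℝ with u_i ≥ 0 everywhere, satisfying −Δu_i = ∑_{j=1}^n β_ij u_j² u_i on ℝ^N for every i, and u_i ≢ 0 for at least one i. -/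
open Finset

/-- The Laplacian of a function `f : ℝ^N → ℝ`: the sum of the second partial
derivatives in the coordinate directions. -/
noncomputable def laplacian {N : ℕ} (f : (Fin N → ℝ) → ℝ) (x : Fin N → ℝ) : ℝ :=
  ∑ i : Fin N, fderiv ℝ (fun y => fderiv ℝ f y (Pi.single i 1)) x (Pi.single i 1)

namespace Sol
open Filter Topology

variable {ι : Type} [Fintype ι]

noncomputable def qf (M : ι → ι → ℝ) (x : ι → ℝ) : ℝ := ∑ i, ∑ j, M i j * x i * x j

noncomputable def bf (M : ι → ι → ℝ) (x y : ι → ℝ) : ℝ := ∑ i, ∑ j, M i j * x i * y j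

noncomputable def FF (a : ι → ℝ) (M : ι → ι → ℝ) (t : ι → ℝ) : ℝ :=
  1 / 2 * ∑ i, a i * t i - 1 / 4 * qf M t

lemma bf_comm (M : ι → ι → ℝ) (hM : ∀ i j, M i j = M j i) (x y : ι → ℝ) :
    bf M x y = bf M y x := by
  unfold bf
  rw [Finset.sum_comm]
  refine Finset.sum_congr rfl fun i _ => Finset.sum_congr rfl fun j _ => ?_
  rw [hM]; ring

lemma qf_add (M : ι → ι → ℝ) (hM : ∀ i j, M i j = M j i) (x y : ι → ℝ) (s : ℝ) :
    qf M (fun i => x i + s * y i) = qf M x + 2 * s * bf M x y + s ^ 2 * qf M y := by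
  have h1 : qf M (fun i => x i + s * y i) = bf M x x + s * bf M x y + s * bf M y x
      + s ^ 2 * bf M y y := by
    unfold qf bf
    simp only [Finset.mul_sum, ← Finset.sum_add_distrib]
    refine Finset.sum_congr rfl fun i _ => Finset.sum_congr rfl fun j _ => ?_
    ring
  rw [h1, bf_comm M hM y x]
  change qf M x + _ + _ + s ^ 2 * qf M y = _
  ring

lemma qf_smul (M : ι → ι → ℝ) (x : ι → ℝ) (s : ℝ) :
    qf M (fun i => s * x i) = s ^ 2 * qf M x := by
  unfold qf
  simp only [Finset.mul_sum]
  refine Finset.sum_congr rfl fun i _ => Finset.sum_congr rfl fun j _ => ?_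
  ring

lemma qf_cont (M : ι → ι → ℝ) : Continuous (qf M) := by
  unfold qf; fun_prop

lemma bf_smul (M : ι → ι → ℝ) (x y : ι → ℝ) (s : ℝ) :
    bf M x (fun i => s * y i) = s * bf M x y := by
  unfold bf
  simp only [Finset.mul_sum]
  refine Finset.sum_congr rfl fun i _ => Finset.sum_congr rfl fun j _ => ?_
  ring

/-- auxiliary sign lemma -/
lemma sign_aux (B : ι → ι → ℝ) (hB : ∀ i j, B i j = B j i)
    (hmin : ∀ c : ι → ℝ, (∀ i, 0 ≤ c i) → c ≠ 0 → (∃ i, c i = 0) → 0 < qf B c)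
    (c : ι → ℝ) (hc : ∀ i, 0 < c i) (hq : qf B c < 0)
    (y : ι → ℝ) (hy : y ≠ 0) (hqy : qf B y ≤ 0) (hb : bf B c y ≤ 0) :
    (∀ i, 0 < y i) ∨ (∀ i, y i < 0) := by
  classical
  by_cases hpos : ∀ i, 0 ≤ y i
  · left
    intro i
    rcases (hpos i).lt_or_eq with h | h
    · exact h
    · exact absurd (hmin y hpos hy ⟨i, h.symm⟩) (not_lt.mpr hqy)
  · right
    push Not at hpos
    obtain ⟨i0, hi0⟩ := hpos
    have hne : (univ.filter (fun i => y i < 0)).Nonempty := ⟨i0, by simp [hi0]⟩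
    obtain ⟨k, hk, hkmin⟩ := Finset.exists_min_image _ (fun i => c i / (-y i)) hne
    simp only [Finset.mem_filter, Finset.mem_univ, true_and] at hk hkmin
    set s := c k / (-y k) with hs
    have hspos : 0 < s := div_pos (hc k) (by linarith)
    have hnn : ∀ i, 0 ≤ c i + s * y i := by
      intro i
      by_cases h : y i < 0
      · have := hkmin i h
        rw [le_div_iff₀ (by linarith)] at this
        linarith
      · have := hc i
        have : 0 ≤ s * y i := mul_nonneg hspos.le (by linarith)
        linarith [hc i]
    have hk0 : c k + s * y k = 0 := by
      have hyk : y k ≠ 0 := hk.ne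
      rw [hs, div_neg, neg_mul, div_mul_cancel₀ _ hyk]; ring
    have hval : qf B (fun i => c i + s * y i) ≤ 0 := by
      rw [qf_add B hB]
      have h1 : 2 * s * bf B c y ≤ 0 := mul_nonpos_of_nonneg_of_nonpos (by linarith) hb
      have h2 : s ^ 2 * qf B y ≤ 0 := mul_nonpos_of_nonneg_of_nonpos (by positivity) hqy
      linarith
    have hz : (fun i => c i + s * y i) = 0 := by
      by_contra hcon
      exact absurd (hmin _ hnn hcon ⟨k, hk0⟩) (not_lt.mpr hval)
    intro i
    have := congrFun hz i
    simp only [Pi.zero_apply] at this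
    have h3 := hc i
    by_contra hcon
    have : 0 ≤ s * y i := mul_nonneg hspos.le (by linarith)
    linarith

lemma sign_lemma (B : ι → ι → ℝ) (hB : ∀ i j, B i j = B j i)
    (hmin : ∀ c : ι → ℝ, (∀ i, 0 ≤ c i) → c ≠ 0 → (∃ i, c i = 0) → 0 < qf B c)
    (c : ι → ℝ) (hc : ∀ i, 0 < c i) (hq : qf B c < 0)
    (y : ι → ℝ) (hy : y ≠ 0) (hqy : qf B y ≤ 0) :
    (∀ i, 0 < y i) ∨ (∀ i, y i < 0) := by
  rcases le_total (bf B c y) 0 with h | h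
  · exact sign_aux B hB hmin c hc hq y hy hqy h
  · have h1 := sign_aux B hB hmin c hc hq (fun i => (-1) * y i)
      (by intro h0; apply hy; funext i; have := congrFun h0 i; simpa using this)
      (by rw [qf_smul]; linarith) (by rw [bf_smul]; linarith)
    rcases h1 with h1 | h1
    · right; intro i; linarith [h1 i]
    · left; intro i; linarith [h1 i]

lemma coercive [Nonempty ι] (M : ι → ι → ℝ) (hpd : ∀ x : ι → ℝ, x ≠ 0 → 0 < qf M x) :
    ∃ m > 0, ∀ x : ι → ℝ, m * ‖x‖ ^ 2 ≤ qf M x := by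
  have hcomp : IsCompact (Metric.sphere (0 : ι → ℝ) 1) := isCompact_sphere _ _
  have hne : (Metric.sphere (0 : ι → ℝ) 1).Nonempty := NormedSpace.sphere_nonempty.mpr zero_le_one
  obtain ⟨x0, hx0, hmin⟩ := hcomp.exists_isMinOn hne (qf_cont M).continuousOn
  have hx0n : x0 ≠ 0 := by
    rintro rfl; simp at hx0
  refine ⟨qf M x0, hpd x0 hx0n, fun x => ?_⟩
  by_cases hx : x = 0
  · subst hx; simp [qf]
  · have hn : 0 < ‖x‖ := norm_pos_iff.mpr hx
    have h1 : (fun i => ‖x‖⁻¹ * x i) ∈ Metric.sphere (0 : ι → ℝ) 1 := by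
      have : (fun i => ‖x‖⁻¹ * x i) = ‖x‖⁻¹ • x := by ext i; simp
      rw [this, mem_sphere_zero_iff_norm, norm_smul, norm_inv, norm_norm]
      exact inv_mul_cancel₀ hn.ne'
    have h2 := hmin h1
    simp only [Set.mem_ofPred_eq] at h2
    rw [qf_smul] at h2
    have h3 := mul_le_mul_of_nonneg_right h2 (sq_nonneg ‖x‖)
    have h4 : ‖x‖⁻¹ ^ 2 * qf M x * ‖x‖ ^ 2 = qf M x := by field_simp
    linarith

lemma lin_bound (a t : ι → ℝ) : |∑ i, a i * t i| ≤ (∑ i, |a i|) * ‖t‖ := by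
  refine (Finset.abs_sum_le_sum_abs _ _).trans ?_
  rw [Finset.sum_mul]
  refine Finset.sum_le_sum fun i _ => ?_
  rw [abs_mul]
  exact mul_le_mul_of_nonneg_left (norm_le_pi_norm t i) (abs_nonneg _)

lemma qf_bound (M : ι → ι → ℝ) (t : ι → ℝ) : |qf M t| ≤ (∑ i, ∑ j, |M i j|) * ‖t‖ ^ 2 := by
  unfold qf
  refine (Finset.abs_sum_le_sum_abs _ _).trans ?_
  rw [Finset.sum_mul]
  refine Finset.sum_le_sum fun i _ => ?_
  refine (Finset.abs_sum_le_sum_abs _ _).trans ?_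
  rw [Finset.sum_mul]
  refine Finset.sum_le_sum fun j _ => ?_
  rw [abs_mul, abs_mul, mul_assoc, sq]
  gcongr
  · exact norm_le_pi_norm t i
  · exact norm_le_pi_norm t j

lemma FF_cont (a : ι → ℝ) (M : ι → ι → ℝ) : Continuous (FF a M) := by
  unfold FF
  have := qf_cont M
  fun_prop

lemma exists_max [Nonempty ι] (a : ι → ℝ) (M : ι → ι → ℝ)
    (hpd : ∀ x : ι → ℝ, x ≠ 0 → 0 < qf M x) :
    ∃ t : ι → ℝ, (∀ i, 0 ≤ t i) ∧ ∀ s : ι → ℝ, (∀ i, 0 ≤ s i) → FF a M s ≤ FF a M t := by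
  obtain ⟨m, hm, hco⟩ := coercive M hpd
  set A := ∑ i, |a i| with hA
  have hA0 : 0 ≤ A := Finset.sum_nonneg fun i _ => abs_nonneg _
  set R := 2 * A / m with hR
  have hR0 : 0 ≤ R := by positivity
  have hcomp : IsCompact (Metric.closedBall (0 : ι → ℝ) R ∩ {t | ∀ i, 0 ≤ t i}) := by
    refine (isCompact_closedBall _ _).inter_right ?_
    rw [Set.ofPred_forall]
    exact isClosed_iInter fun i => isClosed_le continuous_const (continuous_apply i)
  have hz : (0 : ι → ℝ) ∈ Metric.closedBall (0 : ι → ℝ) R ∩ {t | ∀ i, 0 ≤ t i} := by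
    simp [hR0]
  obtain ⟨t, ht, hmax⟩ := hcomp.exists_isMaxOn ⟨0, hz⟩ (FF_cont a M).continuousOn
  refine ⟨t, ht.2, fun s hs => ?_⟩
  by_cases hsR : ‖s‖ ≤ R
  · exact hmax ⟨by simpa using hsR, hs⟩
  · have h0 : FF a M 0 ≤ FF a M t := hmax hz
    have h00 : FF a M 0 = 0 := by simp [FF, qf]
    have h1 := le_trans (le_abs_self _) (lin_bound a s)
    have h2 := hco s
    push Not at hsR
    rw [hR, div_lt_iff₀ hm] at hsR
    have h3 : FF a M s ≤ 0 := by
      unfold FF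
      have : 2 * A * ‖s‖ ≤ ‖s‖ * m * ‖s‖ := mul_le_mul_of_nonneg_right hsR.le (norm_nonneg _)
      nlinarith
    linarith

/-- strong concavity at a maximizer -/
lemma strong (a : ι → ℝ) (M : ι → ι → ℝ) (hM : ∀ i j, M i j = M j i) (m : ℝ)
    (hco : ∀ x : ι → ℝ, m * ‖x‖ ^ 2 ≤ qf M x) (hm : 0 < m)
    (t : ι → ℝ) (ht : ∀ i, 0 ≤ t i)
    (hmax : ∀ s : ι → ℝ, (∀ i, 0 ≤ s i) → FF a M s ≤ FF a M t)
    (s : ι → ℝ) (hs : ∀ i, 0 ≤ s i) :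
    FF a M s ≤ FF a M t - m / 4 * ‖fun i => s i - t i‖ ^ 2 := by
  set z : ι → ℝ := fun i => s i - t i with hz
  have hexp : ∀ r : ℝ, FF a M (fun i => t i + r * z i) = FF a M t
      + r * (1 / 2 * ∑ i, a i * z i - 1 / 2 * bf M t z) - r ^ 2 / 4 * qf M z := by
    intro r
    unfold FF
    rw [qf_add M hM]
    have : ∑ i, a i * (t i + r * z i) = ∑ i, a i * t i + r * ∑ i, a i * z i := by
      rw [Finset.mul_sum, ← Finset.sum_add_distrib]
      exact Finset.sum_congr rfl fun i _ => by ring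
    rw [this]; ring
  set L := 1 / 2 * ∑ i, a i * z i - 1 / 2 * bf M t z with hL
  have hL0 : L ≤ 0 := by
    by_contra hcon
    push Not at hcon
    have hq0 : 0 ≤ qf M z := le_trans (by positivity) (hco z)
    set r := min 1 (L / (qf M z + 1)) with hr
    have hr0 : 0 < r := lt_min one_pos (by positivity)
    have hr1 : r ≤ 1 := min_le_left _ _
    have hr2 : r * (qf M z + 1) ≤ L := by
      rw [← le_div_iff₀ (by positivity)]; exact min_le_right _ _
    have h1 := hmax (fun i => t i + r * z i) (fun i => by
      have : t i + r * z i = (1 - r) * t i + r * s i := by simp only [hz]; ring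
      rw [this]
      have := ht i; have := hs i
      have : 0 ≤ 1 - r := by linarith
      positivity)
    rw [hexp r] at h1
    nlinarith
  have h1 := hexp 1
  have h2 : (fun i => t i + 1 * z i) = s := by ext i; simp [hz]
  rw [h2] at h1
  rw [h1]
  have := hco z
  nlinarith

/-- Danskin -/
lemma danskin [Nonempty ι] (a : ℝ → ι → ℝ) (M : ℝ → ι → ι → ℝ) (a' : ι → ℝ) (M' : ι → ι → ℝ)
    (ha : ∀ i, HasDerivAt (fun ε => a ε i) (a' i) 0)
    (hM : ∀ i j, HasDerivAt (fun ε => M ε i j) (M' i j) 0)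
    (hsym : ∀ i j, M 0 i j = M 0 j i)
    (hpd : ∀ x : ι → ℝ, x ≠ 0 → 0 < qf (M 0) x)
    (t : ι → ℝ) (ht : ∀ i, 0 ≤ t i)
    (hmax : ∀ s : ι → ℝ, (∀ i, 0 ≤ s i) → FF (a 0) (M 0) s ≤ FF (a 0) (M 0) t)
    (hγ : ∀ᶠ ε in 𝓝[>] (0:ℝ), ∀ C, (∀ s : ι → ℝ, (∀ i, 0 ≤ s i) → FF (a ε) (M ε) s ≤ C) →
      FF (a 0) (M 0) t ≤ C) :
    0 ≤ FF a' M' t := by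
  classical
  obtain ⟨m, hm, hco⟩ := coercive (M 0) hpd
  set γ := FF (a 0) (M 0) t with hγdef
  have hex : ∀ᶠ ε in 𝓝[>] (0:ℝ), ∃ s : ι → ℝ, (∀ i, 0 ≤ s i) ∧ γ - ε ^ 2 < FF (a ε) (M ε) s := by
    filter_upwards [hγ, self_mem_nhdsWithin] with ε h hε
    by_contra hcon
    push Not at hcon
    have := h (γ - ε ^ 2) hcon
    have : 0 < ε ^ 2 := pow_pos hε 2
    linarith
  let S : ℝ → ι → ℝ := fun ε => if h : ∃ s : ι → ℝ, (∀ i, 0 ≤ s i) ∧ γ - ε ^ 2 < FF (a ε) (M ε) s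
    then h.choose else t
  have hS : ∀ᶠ ε in 𝓝[>] (0:ℝ), (∀ i, 0 ≤ S ε i) ∧ γ - ε ^ 2 < FF (a ε) (M ε) (S ε) := by
    filter_upwards [hex] with ε h
    have : S ε = h.choose := dif_pos h
    rw [this]; exact h.choose_spec
  have hdiff : ∀ ε s, FF (a ε) (M ε) s - FF (a 0) (M 0) s =
      FF (fun i => a ε i - a 0 i) (fun i j => M ε i j - M 0 i j) s := by
    intro ε s
    unfold FF qf
    simp only [sub_mul, Finset.sum_sub_distrib]
    ring
  let K : ℝ → ℝ := fun ε => ∑ i, |a ε i - a 0 i| + ∑ i, ∑ j, |M ε i j - M 0 i j|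
  have hK0 : ∀ ε, 0 ≤ K ε := fun ε => by positivity
  have hFF : ∀ ε s, FF (a ε) (M ε) s - FF (a 0) (M 0) s ≤ K ε * (1 + ‖s‖ ^ 2) := by
    intro ε s
    rw [hdiff]
    unfold FF
    have h1 := le_trans (le_abs_self _) (lin_bound (fun i => a ε i - a 0 i) s)
    have h2 := le_trans (neg_le_abs _) (qf_bound (fun i j => M ε i j - M 0 i j) s)
    have hx : 0 ≤ ∑ i, |a ε i - a 0 i| := by positivity
    have hy : 0 ≤ ∑ i, ∑ j, |M ε i j - M 0 i j| := by positivity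
    have h3 : ‖s‖ ≤ 1 + ‖s‖ ^ 2 := by nlinarith [sq_nonneg (‖s‖ - 1), norm_nonneg s]
    have h4 := mul_le_mul_of_nonneg_left h3 hx
    have h5 : 0 ≤ (∑ i, |a ε i - a 0 i|) * (1 + ‖s‖ ^ 2) := by positivity
    have h6 : 0 ≤ (∑ i, ∑ j, |M ε i j - M 0 i j|) * ‖s‖ ^ 2 := by positivity
    simp only [K]
    nlinarith
  have hKlim : Tendsto K (𝓝[>] 0) (𝓝 0) := by
    have : Tendsto K (𝓝[>] 0) (𝓝 (∑ i : ι, |a 0 i - a 0 i| + ∑ i, ∑ j, |M 0 i j - M 0 i j|)) := by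
      refine Tendsto.add (tendsto_finsetSum _ fun i _ => ?_)
        (tendsto_finsetSum _ fun i _ => tendsto_finsetSum _ fun j _ => ?_)
      · exact ((((ha i).continuousAt.tendsto).mono_left nhdsWithin_le_nhds).sub_const _).abs
      · exact ((((hM i j).continuousAt.tendsto).mono_left nhdsWithin_le_nhds).sub_const _).abs
    simpa using this
  have hid : Tendsto (fun ε : ℝ => ε) (𝓝[>] 0) (𝓝 0) := tendsto_id.mono_left nhdsWithin_le_nhds
  -- bound on the distance
  have hz : Tendsto (fun ε => ‖fun i => S ε i - t i‖ ^ 2) (𝓝[>] 0) (𝓝 0) := by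
    have hup : Tendsto (fun ε => 8 / m * (ε ^ 2 + K ε * (1 + 2 * ‖t‖ ^ 2))) (𝓝[>] 0) (𝓝 0) := by
      have := ((hid.pow 2).add (hKlim.mul_const (1 + 2 * ‖t‖ ^ 2))).const_mul (8 / m)
      simpa using this
    refine tendsto_of_tendsto_of_tendsto_of_le_of_le' tendsto_const_nhds hup
      (Eventually.of_forall fun _ => by positivity) ?_
    have hKs : ∀ᶠ ε in 𝓝[>] (0:ℝ), K ε < m / 16 := hKlim.eventually_lt_const (by positivity)
    filter_upwards [hS, hKs] with ε h1 h2
    have h3 := strong (a 0) (M 0) hsym m hco hm t ht hmax (S ε) h1.1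
    have h4 := hFF ε (S ε)
    set Z := ‖fun i => S ε i - t i‖ with hZ
    have h5 : ‖S ε‖ ^ 2 ≤ 2 * ‖t‖ ^ 2 + 2 * Z ^ 2 := by
      have : ‖S ε‖ ≤ ‖t‖ + Z := by
        have h := norm_add_le t (fun i => S ε i - t i)
        have h' : t + (fun i => S ε i - t i) = S ε := by ext i; simp
        rwa [h'] at h
      have hZ0 : 0 ≤ Z := norm_nonneg _
      nlinarith [norm_nonneg t, norm_nonneg (S ε), sq_nonneg (‖t‖ - Z)]
    have h6 : K ε * (1 + ‖S ε‖ ^ 2) ≤ K ε * (1 + 2 * ‖t‖ ^ 2) + 2 * K ε * Z ^ 2 := by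
      nlinarith [hK0 ε]
    have h7 : 2 * K ε * Z ^ 2 ≤ m / 8 * Z ^ 2 := by
      nlinarith [sq_nonneg Z]
    have h8 : m / 8 * Z ^ 2 ≤ ε ^ 2 + K ε * (1 + 2 * ‖t‖ ^ 2) := by linarith [h1.2]
    rw [div_mul_eq_mul_div, le_div_iff₀ hm]
    linarith
  have hSt : ∀ i, Tendsto (fun ε => S ε i) (𝓝[>] 0) (𝓝 (t i)) := by
    intro i
    rw [tendsto_iff_norm_sub_tendsto_zero]
    have h1 : Tendsto (fun ε => ‖fun i => S ε i - t i‖) (𝓝[>] 0) (𝓝 0) := by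
      have := hz.sqrt
      simpa [Real.sqrt_sq] using this
    refine squeeze_zero (fun _ => norm_nonneg _) (fun ε => ?_) h1
    exact norm_le_pi_norm (fun i => S ε i - t i) i
  have hlim : Tendsto (fun ε => FF (fun i => ε⁻¹ * (a ε i - a 0 i))
      (fun i j => ε⁻¹ * (M ε i j - M 0 i j)) (S ε) + ε) (𝓝[>] 0) (𝓝 (FF a' M' t + 0)) := by
    refine Tendsto.add ?_ hid
    unfold FF qf
    refine Tendsto.sub (Tendsto.const_mul _ (tendsto_finsetSum _ fun i _ => ?_))
      (Tendsto.const_mul _ (tendsto_finsetSum _ fun i _ => tendsto_finsetSum _ fun j _ => ?_))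
    · refine Tendsto.mul ?_ (hSt i)
      simpa using (ha i).tendsto_slope_zero_right
    · refine Tendsto.mul (Tendsto.mul ?_ (hSt i)) (hSt j)
      simpa using (hM i j).tendsto_slope_zero_right
  rw [add_zero] at hlim
  refine ge_of_tendsto hlim ?_
  filter_upwards [hS, self_mem_nhdsWithin] with ε h1 hε
  have hε : 0 < ε := hε
  have h2 := hmax (S ε) h1.1
  have h3 : 0 ≤ FF (fun i => a ε i - a 0 i) (fun i j => M ε i j - M 0 i j) (S ε) + ε ^ 2 := by
    rw [← hdiff]; linarith [h1.2]
  have h4 : FF (fun i => ε⁻¹ * (a ε i - a 0 i))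
      (fun i j => ε⁻¹ * (M ε i j - M 0 i j)) (S ε) =
      ε⁻¹ * FF (fun i => a ε i - a 0 i) (fun i j => M ε i j - M 0 i j) (S ε) := by
    unfold FF qf
    simp only [mul_assoc, ← Finset.mul_sum]
    ring
  rw [h4]
  have h5 : ε = ε⁻¹ * ε ^ 2 := by field_simp
  have h6 := mul_nonneg (inv_pos.mpr hε).le h3
  rw [mul_add, ← h5] at h6
  exact h6

end Sol

namespace Sol
open Filter Topology MeasureTheory

noncomputable def mu : Measure ℝ := volume.restrict (Set.Ioc 0 1)

instance mu_fin : IsFiniteMeasure mu := by unfold mu; infer_instance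

instance mu_sep : IsSeparable mu := by unfold mu; infer_instance

noncomputable abbrev HH := Lp ℝ 2 mu

noncomputable def ee (x : ℝ) : HH :=
  indicatorConstLp 2 (measurableSet_Ioc : MeasurableSet (Set.Ioc (0:ℝ) x)) (measure_ne_top mu _) 1

noncomputable def cl (x : ℝ) : ℝ := max 0 (min 1 x)

lemma cl_of_mem {x : ℝ} (h : x ∈ Set.Icc (0:ℝ) 1) : cl x = x := by
  unfold cl; rw [min_eq_right h.2, max_eq_right h.1]

lemma inner_ee (x y : ℝ) : inner ℝ (ee x) (ee y) = cl (min x y) := by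
  unfold ee
  rw [L2.inner_indicatorConstLp_indicatorConstLp]
  rw [Set.Ioc_inter_Ioc]
  simp only [mu, measureReal_restrict_apply measurableSet_Ioc, Set.Ioc_inter_Ioc]
  simp [cl, max_comm, min_comm]

lemma norm_ee_sub (x y : ℝ) : ‖ee x - ee y‖ ^ 2 = |cl x - cl y| := by
  rw [norm_sub_sq_real, ← real_inner_self_eq_norm_sq, ← real_inner_self_eq_norm_sq, inner_ee,
    inner_ee, inner_ee, min_self, min_self]
  rcases le_total x y with h | h
  · have : cl x ≤ cl y := by unfold cl; gcongr
    rw [min_eq_left h, abs_of_nonpos (by linarith)]; ring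
  · have : cl y ≤ cl x := by unfold cl; gcongr
    rw [min_eq_right h, abs_of_nonneg (by linarith)]; ring

lemma cl_mem (x : ℝ) : cl x ∈ Set.Icc (0:ℝ) 1 := by
  unfold cl; constructor <;> simp

lemma norm_ee_sub_le (x y : ℝ) : ‖ee x - ee y‖ ≤ 1 := by
  have h := norm_ee_sub x y
  have h1 := cl_mem x
  have h2 := cl_mem y
  have : |cl x - cl y| ≤ 1 := by
    rw [abs_le]; constructor <;> linarith [h1.1, h1.2, h2.1, h2.2]
  rw [← h] at this
  nlinarith [norm_nonneg (ee x - ee y)]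

lemma ee_cont : Continuous ee := by
  rw [continuous_iff_continuousAt]
  intro x
  rw [ContinuousAt, tendsto_iff_norm_sub_tendsto_zero]
  have hcl : Continuous cl := by unfold cl; fun_prop
  have h1 : Tendsto (fun y => √(|cl y - cl x|)) (𝓝 x) (𝓝 (√(|cl x - cl x|))) := by
    apply Continuous.tendsto
    fun_prop
  simp only [sub_self, abs_zero, Real.sqrt_zero] at h1
  refine h1.congr fun y => ?_
  rw [← norm_ee_sub, Real.sqrt_sq (norm_nonneg _)]

lemma ee_zero : ee 0 = 0 := by
  have h := inner_ee 0 0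
  rw [real_inner_self_eq_norm_sq] at h
  have : cl (min (0:ℝ) 0) = 0 := by simp [cl]
  rw [this] at h
  simpa using h

lemma exists_repr (p : ℝ → ℝ) (hp : Measurable p) (C : ℝ)
    (hC : ∀ x ∈ Set.Ioc (0:ℝ) 1, |p x| ≤ C) :
    ∃ g : HH, (∀ x ∈ Set.Icc (0:ℝ) 1, inner ℝ (ee x) g = ∫ y in (0:ℝ)..x, p y) ∧
      ‖g‖ ^ 2 = ∫ y in (0:ℝ)..1, p y ^ 2 := by
  have hmem : MemLp p 2 mu := by
    refine MemLp.of_bound hp.aestronglyMeasurable C ?_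
    unfold mu
    filter_upwards [ae_restrict_mem measurableSet_Ioc] with x hx
    exact hC x hx
  refine ⟨hmem.toLp p, fun x hx => ?_, ?_⟩
  · unfold ee
    rw [L2.inner_indicatorConstLp_one, intervalIntegral.integral_of_le hx.1]
    have : ∫ y in Set.Ioc 0 x, (hmem.toLp p) y ∂mu = ∫ y in Set.Ioc 0 x, p y ∂mu :=
      integral_congr_ae (ae_restrict_of_ae hmem.coeFn_toLp)
    rw [this]
    unfold mu
    rw [Measure.restrict_restrict measurableSet_Ioc, Set.Ioc_inter_Ioc]
    simp [hx.2]
  · rw [← real_inner_self_eq_norm_sq, L2.inner_def, intervalIntegral.integral_of_le zero_le_one]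
    have : ∀ᵐ y ∂mu, inner ℝ ((hmem.toLp p) y) ((hmem.toLp p) y) = p y ^ 2 := by
      filter_upwards [hmem.coeFn_toLp] with y hy
      rw [hy]; simp [sq]
    rw [integral_congr_ae this]
    rfl

lemma weak_compact {E : Type} [NormedAddCommGroup E] [InnerProductSpace ℝ E] [CompleteSpace E]
    [TopologicalSpace.SeparableSpace E] (g : ℕ → E) (R : ℝ) (hg : ∀ k, ‖g k‖ ≤ R) :
    ∃ (g0 : E) (φ : ℕ → ℕ), StrictMono φ ∧
      ∀ h : E, Tendsto (fun k => inner ℝ (g (φ k)) h) atTop (𝓝 (inner ℝ g0 h)) := by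
  have hc := WeakDual.isSeqCompact_closedBall ℝ E 0 R
  let x : ℕ → WeakDual ℝ E := fun k => StrongDual.toWeakDual (InnerProductSpace.toDual ℝ E (g k))
  have hx : ∀ k, x k ∈ WeakDual.toStrongDual ⁻¹' Metric.closedBall (0 : StrongDual ℝ E) R := by
    intro k
    have h1 : ‖(InnerProductSpace.toDual ℝ E (g k))‖ ≤ R := by simpa using hg k
    simpa [x] using h1
  obtain ⟨y, _, φ, hφ, hlim⟩ := hc hx
  refine ⟨(InnerProductSpace.toDual ℝ E).symm (WeakDual.toStrongDual y), φ, hφ, fun h => ?_⟩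
  have h1 := ((WeakDual.eval_continuous h).tendsto y).comp hlim
  rw [InnerProductSpace.toDual_symm_apply]
  exact h1

noncomputable def fn (w : ℝ × HH) (x : ℝ) : ℝ := w.1 + inner ℝ (ee x) w.2

lemma fn_cont (w : ℝ × HH) : Continuous (fn w) := by
  unfold fn
  have := ee_cont
  fun_prop

lemma fn_add (w v : ℝ × HH) (x : ℝ) : fn (w + v) x = fn w x + fn v x := by
  unfold fn; simp [inner_add_right]; ring

lemma fn_smul (c : ℝ) (w : ℝ × HH) (x : ℝ) : fn (c • w) x = c * fn w x := by
  unfold fn; simp [inner_smul_right]; ring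

lemma fn_osc (w : ℝ × HH) (x y : ℝ) : |fn w x - fn w y| ≤ ‖w.2‖ := by
  unfold fn
  rw [add_sub_add_left_eq_sub, ← inner_sub_left]
  refine (abs_real_inner_le_norm _ _).trans ?_
  have := norm_ee_sub_le x y
  nlinarith [norm_nonneg w.2]

lemma fn_zero (w : ℝ × HH) : fn w 0 = w.1 := by simp [fn, ee_zero]

/-- sup bound for normalized functions -/
lemma fn_bound (w : ℝ × HH) (hw : ∫ x in (0:ℝ)..1, fn w x ^ 2 = 1) (x : ℝ) :
    |fn w x| ≤ 1 + ‖w.2‖ := by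
  have hc := fn_cont w
  have : ∃ y ∈ Set.Icc (0:ℝ) 1, |fn w y| ≤ 1 := by
    by_contra hcon
    push Not at hcon
    have : (∫ x in (0:ℝ)..1, (1:ℝ)) < ∫ x in (0:ℝ)..1, fn w x ^ 2 := by
      apply intervalIntegral.integral_lt_integral_of_continuousOn_of_le_of_exists_lt one_pos
      · exact continuousOn_const
      · exact (hc.pow 2).continuousOn
      · intro y hy
        have := hcon y ⟨hy.1.le, hy.2⟩
        rw [← sq_abs]; nlinarith
      · refine ⟨0, by simp, ?_⟩
        have := hcon 0 (by simp)
        rw [← sq_abs]; nlinarith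
    rw [hw] at this
    simp at this
  obtain ⟨y, _, hy⟩ := this
  have h1 := fn_osc w x y
  have h2 := abs_sub_abs_le_abs_sub (fn w x) (fn w y)
  linarith

end Sol

namespace Sol
open Filter Topology MeasureTheory

variable {ι : Type} [Fintype ι]

noncomputable def aa (u : ι → ℝ × HH) (i : ι) : ℝ := ‖(u i).2‖ ^ 2

noncomputable def MM (B : ι → ι → ℝ) (u : ι → ℝ × HH) (i j : ι) : ℝ :=
  B i j * ∫ x in (0:ℝ)..1, fn (u i) x ^ 2 * fn (u j) x ^ 2

def Adm (B : ι → ι → ℝ) (u : ι → ℝ × HH) (C : ℝ) : Prop :=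
  ∀ t : ι → ℝ, (∀ i, 0 ≤ t i) → FF (aa u) (MM B u) t ≤ C

def Nrm (u : ι → ℝ × HH) : Prop := ∀ i, ∫ x in (0:ℝ)..1, fn (u i) x ^ 2 = 1

def IsM (B : ι → ι → ℝ) (u : ι → ℝ × HH) (γ : ℝ) : Prop :=
  Nrm u ∧ Adm B u γ ∧ ∀ (v : ι → ℝ × HH) (C : ℝ),
    (∀ i, 0 < ∫ x in (0:ℝ)..1, fn (v i) x ^ 2) → Adm B v C → γ ≤ C

lemma MM_symm (B : ι → ι → ℝ) (hB : ∀ i j, B i j = B j i) (u : ι → ℝ × HH) (i j : ι) :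
    MM B u i j = MM B u j i := by
  unfold MM; rw [hB i j]; simp only [mul_comm]

lemma normalize (B : ι → ι → ℝ) (v : ι → ℝ × HH) (C : ℝ)
    (hv : ∀ i, 0 < ∫ x in (0:ℝ)..1, fn (v i) x ^ 2) (hA : Adm B v C) :
    ∃ u : ι → ℝ × HH, Nrm u ∧ Adm B u C := by
  let κ : ι → ℝ := fun i => (√(∫ x in (0:ℝ)..1, fn (v i) x ^ 2))⁻¹
  have hκ : ∀ i, κ i ^ 2 * ∫ x in (0:ℝ)..1, fn (v i) x ^ 2 = 1 := by
    intro i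
    simp only [κ, inv_pow]
    rw [Real.sq_sqrt (hv i).le]
    exact inv_mul_cancel₀ (hv i).ne'
  refine ⟨fun i => κ i • v i, fun i => ?_, fun t ht => ?_⟩
  · simp only [fn_smul, mul_pow]
    rw [intervalIntegral.integral_const_mul, hκ]
  · have h1 := hA (fun i => κ i ^ 2 * t i) (fun i => mul_nonneg (sq_nonneg _) (ht i))
    refine le_of_eq_of_le ?_ h1
    unfold FF qf aa MM
    congr 2
    · refine Finset.sum_congr rfl fun i _ => ?_
      simp only [Prod.smul_snd, norm_smul, mul_pow, Real.norm_eq_abs, sq_abs]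
      ring
    · refine Finset.sum_congr rfl fun i _ => Finset.sum_congr rfl fun j _ => ?_
      have : ∫ x in (0:ℝ)..1, fn (κ i • v i) x ^ 2 * fn (κ j • v j) x ^ 2
          = (κ i ^ 2 * κ j ^ 2) * ∫ x in (0:ℝ)..1, fn (v i) x ^ 2 * fn (v j) x ^ 2 := by
        rw [← intervalIntegral.integral_const_mul]
        congr 1; ext x
        rw [fn_smul, fn_smul]; ring
      rw [this]; ring

lemma repr_C1 (v : ℝ → ℝ) (hv : ContDiff ℝ 1 v) :
    ∃ w : ℝ × HH, ∀ x ∈ Set.Icc (0:ℝ) 1, fn w x = v x := by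
  have hd : Continuous (deriv v) := hv.continuous_deriv le_rfl
  obtain ⟨C, hC⟩ := (isCompact_Icc (a := (0:ℝ)) (b := 1)).exists_bound_of_continuousOn
    hd.continuousOn
  obtain ⟨g, hg, _⟩ := exists_repr (deriv v) hd.measurable C
    (fun x hx => hC x ⟨hx.1.le, hx.2⟩)
  refine ⟨(v 0, g), fun x hx => ?_⟩
  simp only [fn]
  rw [hg x hx, intervalIntegral.integral_deriv_eq_sub
    (fun y _ => (hv.differentiable one_ne_zero) y) (hd.intervalIntegrable _ _)]
  ring

lemma exists_adm (B : ι → ι → ℝ) (hd : ∀ i, 0 < B i i) :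
    ∃ (u : ι → ℝ × HH) (C : ℝ), Nrm u ∧ Adm B u C := by
  classical
  by_cases hι : Nonempty ι
  swap
  · refine ⟨fun i => (hι ⟨i⟩).elim, 0, fun i => (hι ⟨i⟩).elim, fun t _ => ?_⟩
    have : IsEmpty ι := not_nonempty_iff.mp hι
    simp [FF, qf]
  have hn : 0 < (Fintype.card ι : ℝ) := by exact_mod_cast Fintype.card_pos
  set n : ℝ := (Fintype.card ι : ℝ) with hndef
  let e := Fintype.equivFin ι
  let c : ι → ℝ := fun i => ((e i : ℕ) + 1 / 2 : ℝ) / n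
  let b : ∀ i, ContDiffBump (c i) := fun i => ⟨1 / (4 * n), 1 / (2 * n), by positivity, by
    apply one_div_lt_one_div_of_lt <;> linarith⟩
  have hsep : ∀ i j, i ≠ j → ∀ x, b i x * b j x = 0 := by
    intro i j hij x
    by_contra hcon
    have h1 : b i x ≠ 0 := left_ne_zero_of_mul hcon
    have h2 : b j x ≠ 0 := right_ne_zero_of_mul hcon
    have h1 : x ∈ Metric.ball (c i) (1 / (2 * n)) := by
      have := (b i).support_eq; rw [← this]; exact h1
    have h2 : x ∈ Metric.ball (c j) (1 / (2 * n)) := by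
      have := (b j).support_eq; rw [← this]; exact h2
    rw [Metric.mem_ball, Real.dist_eq] at h1 h2
    have h3 : |c i - c j| < 1 / n := by
      have : 1 / n = 1 / (2 * n) + 1 / (2 * n) := by field_simp; norm_num
      rw [this]
      calc |c i - c j| ≤ |c i - x| + |x - c j| := abs_sub_le _ _ _
        _ < _ := by rw [abs_sub_comm]; linarith
    have h4 : c i - c j = (((e i : ℕ) : ℝ) - ((e j : ℕ) : ℝ)) / n := by
      simp only [c]; ring
    rw [h4, abs_div, abs_of_pos hn, div_lt_div_iff_of_pos_right hn] at h3
    have h5 : |((e i : ℕ) : ℤ) - ((e j : ℕ) : ℤ)| < 1 := by exact_mod_cast h3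
    rw [Int.abs_lt_one_iff] at h5
    apply hij
    apply e.injective
    ext; omega
  have hcm : ∀ i, c i ∈ Set.Ioo (0:ℝ) 1 := by
    intro i
    have h1 : ((e i : ℕ) : ℝ) + 1 ≤ n := by
      rw [hndef]; exact_mod_cast (e i).2
    constructor
    · positivity
    · simp only [c]; rw [div_lt_one hn]; linarith
  choose w hw using fun i => repr_C1 (b i) ((b i).contDiff)
  have hpos : ∀ (k : ℕ), ∀ i, 0 < ∫ x in (0:ℝ)..1, fn (w i) x ^ (2 * k) := by
    intro k i
    apply intervalIntegral.integral_pos one_pos (f := fun x => fn (w i) x ^ (2 * k))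
      ((fn_cont _).pow _).continuousOn
    · intro x _; rw [pow_mul]; positivity
    · refine ⟨c i, ⟨(hcm i).1.le, (hcm i).2.le⟩, ?_⟩
      rw [hw i _ ⟨(hcm i).1.le, (hcm i).2.le⟩, (b i).one_of_mem_closedBall]
      · simp
      · simp [(b i).rIn_pos.le]
  have hMoff : ∀ i j, i ≠ j → MM B w i j = 0 := by
    intro i j hij
    unfold MM
    have : ∫ x in (0:ℝ)..1, fn (w i) x ^ 2 * fn (w j) x ^ 2 = ∫ x in (0:ℝ)..1, (0:ℝ) := by
      apply intervalIntegral.integral_congr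
      intro x hx
      rw [Set.uIcc_of_le zero_le_one] at hx
      simp only
      rw [hw i x hx, hw j x hx, ← mul_pow, hsep i j hij]; simp
    rw [this]; simp
  have hMd : ∀ i, 0 < MM B w i i := by
    intro i
    unfold MM
    refine mul_pos (hd i) ?_
    have := hpos 2 i
    refine this.trans_eq ?_
    congr 1; ext x; ring
  obtain ⟨u, hu1, hu2⟩ := normalize B w (∑ i, (aa w i) ^ 2 / (4 * MM B w i i)) (hpos 1) (by
    intro t _
    unfold FF qf
    rw [Finset.mul_sum, Finset.mul_sum, ← Finset.sum_sub_distrib]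
    refine Finset.sum_le_sum fun i _ => ?_
    rw [Finset.sum_eq_single i (fun j _ hj => by rw [hMoff i j hj.symm]; simp) (by simp)]
    have h := hMd i
    rw [le_div_iff₀ (by positivity)]
    nlinarith [sq_nonneg (aa w i - MM B w i i * t i)])
  exact ⟨u, _, hu1, hu2⟩

lemma adm_bound (B : ι → ι → ℝ) (hd : ∀ i, 0 < B i i) (u : ι → ℝ × HH) (C : ℝ)
    (hu : Nrm u) (hA : Adm B u C) (i : ι) : ‖(u i).2‖ ≤ 1 + 16 * C * B i i := by
  classical
  set G := ‖(u i).2‖ with hG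
  have hG0 : 0 ≤ G := norm_nonneg _
  have hb := hd i
  have hC : 0 ≤ C := by
    have := hA 0 (by simp)
    simpa [FF, qf] using this
  have hM : MM B u i i ≤ B i i * (1 + G) ^ 2 := by
    unfold MM
    refine mul_le_mul_of_nonneg_left ?_ hb.le
    calc ∫ x in (0:ℝ)..1, fn (u i) x ^ 2 * fn (u i) x ^ 2
        ≤ ∫ x in (0:ℝ)..1, (1 + G) ^ 2 * fn (u i) x ^ 2 := by
          have hc := fn_cont (u i)
          apply intervalIntegral.integral_mono_on zero_le_one
          · exact Continuous.intervalIntegrable (by fun_prop) _ _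
          · exact Continuous.intervalIntegrable (by fun_prop) _ _
          · intro x _
            refine mul_le_mul_of_nonneg_right ?_ (sq_nonneg _)
            rw [← sq_abs]
            exact pow_le_pow_left₀ (abs_nonneg _) (fn_bound _ (hu i) x) 2
      _ = (1 + G) ^ 2 := by rw [intervalIntegral.integral_const_mul, hu i, mul_one]
  have hF : ∀ r : ℝ, 0 ≤ r → 1 / 2 * (G ^ 2 * r) - 1 / 4 * (MM B u i i * r * r) ≤ C := by
    intro r hr
    have := hA (Pi.single i r) (by intro j; by_cases h : j = i <;> simp [Pi.single_apply, h, hr])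
    unfold FF qf at this
    simpa [Pi.single_apply, aa] using this
  have h1 := hF (G ^ 2 / (B i i * (1 + G) ^ 2)) (by positivity)
  set D := B i i * (1 + G) ^ 2 with hD
  have hD0 : 0 < D := by positivity
  have h2 : 1 / 4 * (G ^ 2 * (G ^ 2 / D)) ≤ C := by
    have h3 : MM B u i i * (G ^ 2 / D) * (G ^ 2 / D) ≤ D * (G ^ 2 / D) * (G ^ 2 / D) := by
      gcongr
    have h4 : D * (G ^ 2 / D) * (G ^ 2 / D) = G ^ 2 * (G ^ 2 / D) := by field_simp
    linarith
  have h5 : G ^ 4 ≤ 4 * C * D := by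
    have : 1 / 4 * (G ^ 2 * (G ^ 2 / D)) = G ^ 4 / (4 * D) := by field_simp
    rw [this, div_le_iff₀ (by positivity)] at h2
    linarith
  by_cases h1G : G ≤ 1
  · have : 0 ≤ 16 * C * B i i := by positivity
    linarith
  · push Not at h1G
    have h6 : (1 + G) ^ 2 ≤ 4 * G ^ 2 := by nlinarith
    have h7 : G ^ 4 ≤ (16 * C * B i i) * G ^ 2 := by
      have : 4 * C * D ≤ 4 * C * (B i i * (4 * G ^ 2)) := by rw [hD]; gcongr
      linarith
    have h8 : G ^ 2 ≤ 16 * C * B i i := by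
      have : 0 < G ^ 2 := by positivity
      by_contra hcon
      push Not at hcon
      nlinarith
    nlinarith

lemma exists_isM (B : ι → ι → ℝ) (hd : ∀ i, 0 < B i i) :
    ∃ (u : ι → ℝ × HH) (γ : ℝ), IsM B u γ := by
  classical
  let Γ : Set ℝ := {C | ∃ u : ι → ℝ × HH, Nrm u ∧ Adm B u C}
  have hΓne : Γ.Nonempty := by
    obtain ⟨u, C, h1, h2⟩ := exists_adm B hd
    exact ⟨C, u, h1, h2⟩
  have hΓ0 : ∀ C ∈ Γ, 0 ≤ C := by
    rintro C ⟨u, _, hA⟩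
    have := hA 0 (by simp)
    simpa [FF, qf] using this
  have hΓb : BddBelow Γ := ⟨0, hΓ0⟩
  set γ := sInf Γ with hγ
  have hγ0 : 0 ≤ γ := le_csInf hΓne hΓ0
  have hseq : ∀ k : ℕ, ∃ u : ι → ℝ × HH, Nrm u ∧ Adm B u (γ + 1 / ((k:ℝ) + 1)) := by
    intro k
    have hk : (0:ℝ) < 1 / ((k:ℝ) + 1) := by positivity
    obtain ⟨C, ⟨u, h1, h2⟩, hC⟩ := exists_lt_of_csInf_lt hΓne (lt_add_of_pos_right γ hk)
    exact ⟨u, h1, fun t ht => (h2 t ht).trans hC.le⟩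
  choose u hu hA using hseq
  set R := 1 + 16 * (γ + 1) * ∑ i, B i i with hR
  have hgR : ∀ k i, ‖(u k i).2‖ ≤ R := by
    intro k i
    have h := adm_bound B hd (u k) (γ + 1) (hu k) (fun t ht => (hA k t ht).trans (by
      have : 1 / ((k:ℝ) + 1) ≤ 1 := by
        rw [div_le_one (by positivity)]; linarith [(Nat.cast_nonneg k : (0:ℝ) ≤ k)]
      linarith)) i
    have h2 : B i i ≤ ∑ i, B i i := Finset.single_le_sum (fun j _ => (hd j).le) (Finset.mem_univ i)
    have : 16 * (γ + 1) * B i i ≤ 16 * (γ + 1) * ∑ i, B i i := by gcongr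
    linarith
  have hfR : ∀ k i x, |fn (u k i) x| ≤ 1 + R := fun k i x =>
    (fn_bound _ (hu k i) x).trans (by linarith [hgR k i])
  -- extract in s
  have hsb : ∀ k, (fun i => (u k i).1) ∈ Metric.closedBall (0 : ι → ℝ) (|1 + R|) := by
    intro k
    rw [mem_closedBall_zero_iff, pi_norm_le_iff_of_nonneg (abs_nonneg _)]
    intro i
    have := hfR k i 0
    rw [fn_zero] at this
    exact this.trans (le_abs_self _)
  obtain ⟨s0, _, φ, hφ, hs0⟩ := (isCompact_closedBall (0 : ι → ℝ) (|1 + R|)).tendsto_subseq hsb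
  have : Fact ((2 : ENNReal) ≠ ⊤) := ⟨by simp⟩
  have hsep1 : TopologicalSpace.SeparableSpace HH := inferInstance
  have hsepp : TopologicalSpace.SeparableSpace (PiLp 2 (fun _ : ι => HH)) :=
    DenseRange.separableSpace (f := fun x : ι → HH => (WithLp.toLp 2 x : PiLp 2 (fun _ : ι => HH)))
      (Function.Surjective.denseRange (fun y => ⟨y.ofLp, rfl⟩)) (PiLp.continuous_toLp 2 _)
  obtain ⟨g0, ψ, hψ, hg0⟩ := weak_compact
    (fun k => (WithLp.toLp 2 (fun i => (u (φ k) i).2) : PiLp 2 (fun _ : ι => HH)))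
    (√(∑ i : ι, R ^ 2)) (by
      intro k
      rw [PiLp.norm_eq_of_L2]
      apply Real.sqrt_le_sqrt
      exact Finset.sum_le_sum fun i _ => pow_le_pow_left₀ (norm_nonneg _) (hgR _ i) 2)
  let u0 : ι → ℝ × HH := fun i => (s0 i, g0 i)
  let v : ℕ → ι → ℝ × HH := fun k => u (φ (ψ k))
  have hginner : ∀ i (h : HH), Tendsto (fun k => inner ℝ (v k i).2 h) atTop
      (𝓝 (inner ℝ (u0 i).2 h)) := by
    intro i h
    have := hg0 (WithLp.toLp 2 (Pi.single i h))
    simp only [PiLp.inner_apply] at this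
    have hs : ∀ G : ι → HH, ∑ j, inner ℝ (G j) ((Pi.single i h : ι → HH) j) = inner ℝ (G i) h := by
      intro G
      rw [Finset.sum_eq_single i]
      · simp
      · intro j _ hj; simp [Pi.single_apply, hj]
      · simp
    have e1 := hs (fun j => g0 j)
    rw [e1] at this
    refine this.congr fun k => ?_
    exact hs (fun j => (u (φ (ψ k)) j).2)
  have hsl : ∀ i, Tendsto (fun k => (v k i).1) atTop (𝓝 (s0 i)) := by
    intro i
    have h1 := (tendsto_pi_nhds.mp hs0 i).comp hψ.tendsto_atTop
    exact h1
  have hfl : ∀ i x, Tendsto (fun k => fn (v k i) x) atTop (𝓝 (fn (u0 i) x)) := by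
    intro i x
    unfold fn
    refine (hsl i).add ?_
    have := hginner i (ee x)
    simpa only [real_inner_comm] using this
  have hN : Nrm u0 := by
    intro i
    have h1 : Tendsto (fun k => ∫ x in (0:ℝ)..1, fn (v k i) x ^ 2) atTop
        (𝓝 (∫ x in (0:ℝ)..1, fn (u0 i) x ^ 2)) := by
      apply intervalIntegral.tendsto_integral_filter_of_dominated_convergence (fun _ => (1 + R) ^ 2)
      · exact Eventually.of_forall fun k => ((fn_cont _).pow 2).aestronglyMeasurable
      · refine Eventually.of_forall fun k => Eventually.of_forall fun x _ => ?_
        rw [norm_pow]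
        exact pow_le_pow_left₀ (norm_nonneg _) (hfR _ i x) 2
      · simp
      · exact Eventually.of_forall fun x _ => (hfl i x).pow 2
    have h2 : (fun k => ∫ x in (0:ℝ)..1, fn (v k i) x ^ 2) = fun _ => 1 :=
      funext fun k => hu _ i
    rw [h2] at h1
    exact tendsto_nhds_unique h1 tendsto_const_nhds
  have hMl : ∀ i j, Tendsto (fun k => MM B (v k) i j) atTop (𝓝 (MM B u0 i j)) := by
    intro i j
    unfold MM
    refine Tendsto.const_mul _ ?_
    apply intervalIntegral.tendsto_integral_filter_of_dominated_convergence
      (fun _ => (1 + R) ^ 2 * (1 + R) ^ 2)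
    · exact Eventually.of_forall fun k =>
        (((fn_cont _).pow 2).mul ((fn_cont _).pow 2)).aestronglyMeasurable
    · refine Eventually.of_forall fun k => Eventually.of_forall fun x _ => ?_
      rw [norm_mul, norm_pow, norm_pow]
      have h1 := pow_le_pow_left₀ (norm_nonneg (fn (v k i) x)) (hfR (φ (ψ k)) i x) 2
      have h2 := pow_le_pow_left₀ (norm_nonneg (fn (v k j) x)) (hfR (φ (ψ k)) j x) 2
      exact mul_le_mul h1 h2 (by positivity) (by positivity)
    · simp
    · exact Eventually.of_forall fun x _ => ((hfl i x).pow 2).mul ((hfl j x).pow 2)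
  refine ⟨u0, γ, hN, fun t ht => ?_, fun w C hw hAw => ?_⟩
  · have hl : Tendsto (fun k => FF (fun i => 2 * inner ℝ (v k i).2 (u0 i).2 - ‖(u0 i).2‖ ^ 2)
        (MM B (v k)) t) atTop
        (𝓝 (FF (fun i => 2 * inner ℝ (u0 i).2 (u0 i).2 - ‖(u0 i).2‖ ^ 2) (MM B u0) t)) := by
      unfold FF qf
      refine Tendsto.sub (Tendsto.const_mul _ (tendsto_finsetSum _ fun i _ => ?_))
        (Tendsto.const_mul _ (tendsto_finsetSum _ fun i _ => tendsto_finsetSum _ fun j _ => ?_))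
      · exact (((hginner i _).const_mul 2).sub_const _).mul_const _
      · exact ((hMl i j).mul_const _).mul_const _
    have he : (fun i => 2 * inner ℝ (u0 i).2 (u0 i).2 - ‖(u0 i).2‖ ^ 2) = aa u0 := by
      ext i; rw [real_inner_self_eq_norm_sq]; unfold aa; ring
    rw [he] at hl
    have hr : Tendsto (fun k : ℕ => γ + 1 / (((φ (ψ k) : ℕ) : ℝ) + 1)) atTop (𝓝 (γ + 0)) := by
      refine Tendsto.const_add _ ?_
      exact (tendsto_one_div_add_atTop_nhds_zero_nat (𝕜 := ℝ)).comp
        ((hφ.comp hψ).tendsto_atTop)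
    rw [add_zero] at hr
    refine le_of_tendsto_of_tendsto' hl hr fun k => ?_
    refine le_trans ?_ (hA (φ (ψ k)) t ht)
    unfold FF
    have : ∑ i, (2 * inner ℝ (v k i).2 (u0 i).2 - ‖(u0 i).2‖ ^ 2) * t i ≤
        ∑ i, aa (u (φ (ψ k))) i * t i := by
      refine Finset.sum_le_sum fun i _ => mul_le_mul_of_nonneg_right ?_ (ht i)
      have h := norm_sub_sq_real (v k i).2 (u0 i).2
      have h' := sq_nonneg ‖(v k i).2 - (u0 i).2‖
      have h3 : aa (u (φ (ψ k))) i = ‖(v k i).2‖ ^ 2 := rfl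
      rw [h3]; linarith
    have h4 : qf (MM B (v k)) t = qf (MM B (u (φ (ψ k)))) t := rfl
    linarith
  · obtain ⟨w', h1, h2⟩ := normalize B w C hw hAw
    exact csInf_le hΓb ⟨w', h1, h2⟩

end Sol

namespace Sol
open Filter Topology MeasureTheory

variable {ι : Type} [Fintype ι]

lemma qf_MM (B : ι → ι → ℝ) (u : ι → ℝ × HH) (x : ι → ℝ) :
    qf (MM B u) x = ∫ s in (0:ℝ)..1, qf B (fun i => x i * fn (u i) s ^ 2) := by
  unfold qf MM
  rw [intervalIntegral.integral_finsetSum]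
  swap
  · intro i _
    have := fun i => fn_cont (u i)
    exact Continuous.intervalIntegrable (by fun_prop) _ _
  refine Finset.sum_congr rfl fun i _ => ?_
  rw [intervalIntegral.integral_finsetSum]
  swap
  · intro j _
    have := fun i => fn_cont (u i)
    exact Continuous.intervalIntegrable (by fun_prop) _ _
  refine Finset.sum_congr rfl fun j _ => ?_
  have : ∀ s, B i j * (x i * fn (u i) s ^ 2) * (x j * fn (u j) s ^ 2) =
    (B i j * x i * x j) * (fn (u i) s ^ 2 * fn (u j) s ^ 2) := fun s => by ring
  simp only [this]
  rw [intervalIntegral.integral_const_mul]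
  ring

lemma FF_smul (a : ι → ℝ) (M : ι → ι → ℝ) (t : ι → ℝ) (r : ℝ) :
    FF a M (fun i => r * t i) = r * (1 / 2 * ∑ i, a i * t i) - r ^ 2 * (1 / 4 * qf M t) := by
  unfold FF
  rw [qf_smul]
  have : ∑ i, a i * (r * t i) = r * ∑ i, a i * t i := by
    rw [Finset.mul_sum]; exact Finset.sum_congr rfl fun i _ => by ring
  rw [this]; ring

lemma not_const (B : ι → ι → ℝ) (c : ι → ℝ) (hc : ∀ i, 0 < c i) (hq : qf B c < 0)
    (u : ι → ℝ × HH) (γ : ℝ) (hu : Nrm u) (hA : Adm B u γ) (h0 : ∀ i, (u i).2 = 0) : False := by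
  have hf : ∀ i x, fn (u i) x = (u i).1 := by
    intro i x; simp [fn, h0 i]
  have h1 : ∀ i, (u i).1 ^ 2 = 1 := by
    intro i
    have := hu i
    simpa [hf] using this
  have hM : MM B u = B := by
    ext i j
    simp [MM, hf, h1]
  have ha : aa u = 0 := by
    ext i; simp [aa, h0 i]
  set r := (4 * (|γ| + 1)) / (-qf B c) with hr
  have hqn : 0 < - qf B c := by linarith
  have hr0 : 0 < r := by positivity
  have h2 := hA (fun i => (r + 1) * c i) (fun i => by have := hc i; positivity)
  rw [FF_smul, hM, ha] at h2
  simp only [Pi.zero_apply, zero_mul, Finset.sum_const_zero, mul_zero, zero_sub] at h2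
  have h3 : r * (- qf B c) = 4 * (|γ| + 1) := by
    rw [hr]; exact div_mul_cancel₀ _ hqn.ne'
  have h4 := le_abs_self γ
  have h5 : r ≤ (r + 1) ^ 2 := by nlinarith
  have h6 := mul_le_mul_of_nonneg_right h5 hqn.le
  linarith

lemma const_of_le (u : ι → ℝ × HH) (i : ι) (h : aa u i ≤ 0) : (u i).2 = 0 := by
  unfold aa at h
  have : ‖(u i).2‖ = 0 := by nlinarith [norm_nonneg (u i).2]
  simpa using this

lemma pd_lemma (B : ι → ι → ℝ) (hB : ∀ i j, B i j = B j i)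
    (hmin : ∀ c : ι → ℝ, (∀ i, 0 ≤ c i) → c ≠ 0 → (∃ i, c i = 0) → 0 < qf B c)
    (c : ι → ℝ) (hc : ∀ i, 0 < c i) (hq : qf B c < 0)
    (u : ι → ℝ × HH) (γ : ℝ) (hu : Nrm u) (hA : Adm B u γ) (x : ι → ℝ) (hx : x ≠ 0) :
    0 < qf (MM B u) x := by
  by_contra hcon
  push Not at hcon
  have hkey : ∀ t : ι → ℝ, (∀ i, 0 < t i) → qf (MM B u) t ≤ 0 → False := by
    intro t ht hqt
    have h1 : ∑ i, aa u i * t i ≤ 0 := by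
      by_contra hpos
      push Not at hpos
      set S := ∑ i, aa u i * t i with hS
      have h2 := hA (fun i => (2 * (|γ| + 1) / S) * t i)
        (fun i => by have := ht i; positivity)
      rw [FF_smul, ← hS] at h2
      have h3 : 2 * (|γ| + 1) / S * (1 / 2 * S) = |γ| + 1 := by field_simp
      have h4 : (2 * (|γ| + 1) / S) ^ 2 * (1 / 4 * qf (MM B u) t) ≤ 0 :=
        mul_nonpos_of_nonneg_of_nonpos (by positivity) (by linarith)
      have := le_abs_self γ
      linarith
    refine not_const B c hc hq u γ hu hA fun i => const_of_le u i ?_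
    have h5 : aa u i * t i ≤ ∑ i, aa u i * t i :=
      Finset.single_le_sum (f := fun i => aa u i * t i)
        (fun j _ => mul_nonneg (sq_nonneg _) (ht j).le) (Finset.mem_univ i)
    have h6 := ht i
    by_contra h7
    push Not at h7
    have := mul_pos h7 h6
    linarith
  by_cases hex : ∃ s ∈ Set.Icc (0:ℝ) 1, (fun i => x i * fn (u i) s ^ 2) ≠ 0 ∧
      qf B (fun i => x i * fn (u i) s ^ 2) ≤ 0
  · obtain ⟨s, _, h1, h2⟩ := hex
    rcases sign_lemma B hB hmin c hc hq _ h1 h2 with h | h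
    · refine hkey x (fun i => ?_) hcon
      exact pos_of_mul_pos_left (h i) (sq_nonneg _)
    · refine hkey (fun i => (-1) * x i) (fun i => ?_) (by rw [qf_smul]; linarith)
      have h3 : 0 < ((-1) * x i) * fn (u i) s ^ 2 := by linarith [h i]
      exact pos_of_mul_pos_left h3 (sq_nonneg _)
  · push Not at hex
    obtain ⟨i, hi⟩ := Function.ne_iff.mp hx
    simp only [Pi.zero_apply] at hi
    have hs : ∃ s ∈ Set.Icc (0:ℝ) 1, fn (u i) s ≠ 0 := by
      by_contra hno
      push Not at hno
      have h1 : ∫ s in (0:ℝ)..1, fn (u i) s ^ 2 = ∫ s in (0:ℝ)..1, (0:ℝ) := by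
        apply intervalIntegral.integral_congr
        intro s hs
        rw [Set.uIcc_of_le zero_le_one] at hs
        simp [hno s hs]
      rw [hu i] at h1
      simp at h1
    obtain ⟨s, hs, hs1⟩ := hs
    have hpos : 0 < qf (MM B u) x := by
      rw [qf_MM]
      apply intervalIntegral.integral_pos one_pos
      · apply Continuous.continuousOn
        apply (qf_cont B).comp
        have := fun i => fn_cont (u i)
        fun_prop
      · intro r hr
        by_cases h0 : (fun i => x i * fn (u i) r ^ 2) = 0
        · rw [h0]; simp [qf]
        · exact (hex r ⟨hr.1.le, hr.2⟩ h0).le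
      · refine ⟨s, hs, hex s hs ?_⟩
        intro h0
        have := congrFun h0 i
        simp only [Pi.zero_apply, mul_eq_zero] at this
        rcases this with h | h
        · exact hi h
        · exact hs1 (by simpa using h)
    linarith

lemma quartic (p q r s : ℝ → ℝ) (hp : Continuous p) (hq : Continuous q) (hr : Continuous r)
    (hs : Continuous s) :
    HasDerivAt (fun ε : ℝ => ∫ x in (0:ℝ)..1, (p x + ε * q x) ^ 2 * (r x + ε * s x) ^ 2)
      (2 * (∫ x in (0:ℝ)..1, p x * q x * r x ^ 2) + 2 * ∫ x in (0:ℝ)..1, r x * s x * p x ^ 2) 0 := by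
  have key : ∀ ε : ℝ, ∫ x in (0:ℝ)..1, (p x + ε * q x) ^ 2 * (r x + ε * s x) ^ 2 =
      (∫ x in (0:ℝ)..1, p x ^ 2 * r x ^ 2) +
      ε * (2 * (∫ x in (0:ℝ)..1, p x * q x * r x ^ 2) + 2 * ∫ x in (0:ℝ)..1, r x * s x * p x ^ 2) +
      ε ^ 2 * (∫ x in (0:ℝ)..1, (q x ^ 2 * r x ^ 2 + 4 * p x * q x * r x * s x + p x ^ 2 * s x ^ 2)) +
      ε ^ 3 * (∫ x in (0:ℝ)..1, (2 * q x ^ 2 * r x * s x + 2 * p x * q x * s x ^ 2)) +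
      ε ^ 4 * (∫ x in (0:ℝ)..1, q x ^ 2 * s x ^ 2) := by
    intro ε
    rw [← intervalIntegral.integral_const_mul, ← intervalIntegral.integral_const_mul,
      ← intervalIntegral.integral_add, ← intervalIntegral.integral_const_mul,
      ← intervalIntegral.integral_const_mul,
      ← intervalIntegral.integral_const_mul, ← intervalIntegral.integral_const_mul,
      ← intervalIntegral.integral_add, ← intervalIntegral.integral_add,
      ← intervalIntegral.integral_add, ← intervalIntegral.integral_add]
    · congr 1; ext x; ring
    all_goals exact Continuous.intervalIntegrable (by fun_prop) _ _
  have hgen : ∀ c0 c1 c2 c3 c4 : ℝ, HasDerivAt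
      (fun ε : ℝ => c0 + ε * c1 + ε ^ 2 * c2 + ε ^ 3 * c3 + ε ^ 4 * c4) c1 0 := by
    intro c0 c1 c2 c3 c4
    have h1 := hasDerivAt_id (0:ℝ)
    have h2 := hasDerivAt_pow 2 (0:ℝ)
    have h3 := hasDerivAt_pow 3 (0:ℝ)
    have h4 := hasDerivAt_pow 4 (0:ℝ)
    have := ((((h1.mul_const c1).const_add c0).add (h2.mul_const c2)).add (h3.mul_const c3)).add
      (h4.mul_const c4)
    exact this.congr_deriv (by norm_num)
  simp only [key]
  exact hgen _ _ _ _ _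

noncomputable def ff (B : ι → ι → ℝ) (u : ι → ℝ × HH) (t : ι → ℝ) (k : ι) (x : ℝ) : ℝ :=
  ∑ j, B k j * t j * fn (u j) x ^ 2 * fn (u k) x

lemma ff_cont (B : ι → ι → ℝ) (u : ι → ℝ × HH) (t : ι → ℝ) (k : ι) :
    Continuous (ff B u t k) := by
  unfold ff
  have := fun i => fn_cont (u i)
  fun_prop

lemma el_ineq [Nonempty ι] (B : ι → ι → ℝ) (hB : ∀ i j, B i j = B j i)
    (u : ι → ℝ × HH) (γ : ℝ) (hu : IsM B u γ)
    (hpd : ∀ x : ι → ℝ, x ≠ 0 → 0 < qf (MM B u) x)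
    (t : ι → ℝ) (ht : ∀ i, 0 ≤ t i) (htγ : FF (aa u) (MM B u) t = γ)
    (k : ι) (w : ℝ × HH) :
    0 ≤ t k * (inner ℝ (u k).2 w.2 - ∫ x in (0:ℝ)..1, ff B u t k x * fn w x) := by
  classical
  obtain ⟨hN, hA, hmn⟩ := hu
  let d : ι → ℝ × HH := fun i => if i = k then w else 0
  let v : ℝ → ι → ℝ × HH := fun ε i => u i + ε • d i
  have hv0 : v 0 = u := by ext1 i; simp [v]
  have hfv : ∀ ε i x, fn (v ε i) x = fn (u i) x + ε * fn (d i) x := by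
    intro ε i x; simp only [v]; rw [fn_add, fn_smul]
  let I : ι → ι → ℝ := fun i j => ∫ x in (0:ℝ)..1, fn (u i) x * fn (d i) x * fn (u j) x ^ 2
  have hd := danskin (fun ε => aa (v ε)) (fun ε => MM B (v ε))
    (fun i => 2 * inner ℝ (u i).2 (d i).2) (fun i j => B i j * (2 * I i j + 2 * I j i))
    (by
      intro i
      have h1 : HasDerivAt (fun ε : ℝ => (u i).2 + ε • (d i).2) ((d i).2) 0 := by
        simpa using ((hasDerivAt_id (0:ℝ)).smul_const (d i).2).const_add (u i).2
      have h2 := h1.norm_sq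
      simpa [aa, v] using h2)
    (by
      intro i j
      have := (quartic (fn (u i)) (fn (d i)) (fn (u j)) (fn (d j)) (fn_cont _) (fn_cont _)
        (fn_cont _) (fn_cont _)).const_mul (B i j)
      simp only [MM, hfv]
      exact this)
    (by rw [hv0]; exact MM_symm B hB u)
    (by rw [hv0]; exact hpd) t ht
    (by rw [hv0, htγ]; exact hA)
    (by
      rw [hv0, htγ]
      have hpos : ∀ i, ∀ᶠ ε in 𝓝[>] (0:ℝ), 0 < ∫ x in (0:ℝ)..1, fn (v ε i) x ^ 2 := by
        intro i
        have h1 := (quartic (fn (u i)) (fn (d i)) (fun _ => 1) (fun _ => 0) (fn_cont _) (fn_cont _)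
          continuous_const continuous_const).continuousAt.tendsto
        have h2 : (0:ℝ) < ∫ x in (0:ℝ)..1, (fn (u i) x + 0 * fn (d i) x) ^ 2 *
            ((1:ℝ) + 0 * 0) ^ 2 := by
          simp only [zero_mul, add_zero, one_pow, mul_one]
          rw [hN i]; exact one_pos
        have h3 := (h1.mono_left (nhdsWithin_le_nhds (s := Set.Ioi 0))).eventually_const_lt h2
        filter_upwards [h3] with ε hε
        simp only [hfv]
        simpa using hε
      have hall : ∀ᶠ ε in 𝓝[>] (0:ℝ), ∀ i, 0 < ∫ x in (0:ℝ)..1, fn (v ε i) x ^ 2 :=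
        eventually_all.mpr hpos
      filter_upwards [hall] with ε hε C hC
      exact hmn (v ε) C hε hC)
  refine hd.trans_eq ?_
  have hI : ∀ i j, i ≠ k → I i j = 0 := by
    intro i j hik
    simp [I, d, hik, fn]
  have e1 : ∑ i, (2 * inner ℝ (u i).2 (d i).2) * t i = 2 * inner ℝ (u k).2 w.2 * t k := by
    rw [Finset.sum_eq_single k]
    · simp [d]
    · intro i _ hik; simp [d, hik]
    · simp
  have e2 : qf (fun i j => B i j * (2 * I i j + 2 * I j i)) t =
      4 * ∑ i, ∑ j, B i j * I i j * t i * t j := by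
    have h1 : ∑ i, ∑ j, B i j * I j i * t i * t j = ∑ i, ∑ j, B i j * I i j * t i * t j := by
      rw [Finset.sum_comm]
      refine Finset.sum_congr rfl fun i _ => Finset.sum_congr rfl fun j _ => ?_
      rw [hB]; ring
    have h2 : qf (fun i j => B i j * (2 * I i j + 2 * I j i)) t =
        2 * ∑ i, ∑ j, B i j * I i j * t i * t j + 2 * ∑ i, ∑ j, B i j * I j i * t i * t j := by
      unfold qf
      simp only [Finset.mul_sum, ← Finset.sum_add_distrib]
      refine Finset.sum_congr rfl fun i _ => Finset.sum_congr rfl fun j _ => ?_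
      ring
    rw [h2, h1]; ring
  have e3 : ∑ i, ∑ j, B i j * I i j * t i * t j = ∑ j, B k j * I k j * t k * t j := by
    rw [Finset.sum_eq_single k]
    · intro i _ hik
      exact Finset.sum_eq_zero fun j _ => by rw [hI i j hik]; ring
    · simp
  have e4 : ∫ x in (0:ℝ)..1, ff B u t k x * fn w x = ∑ j, B k j * t j * I k j := by
    unfold ff
    simp only [Finset.sum_mul]
    have hc := fun i => fn_cont (u i)
    have hw := fn_cont w
    rw [intervalIntegral.integral_finsetSum]
    swap
    · intro i _
      exact Continuous.intervalIntegrable (by fun_prop) _ _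
    refine Finset.sum_congr rfl fun j _ => ?_
    simp only [I]
    rw [← intervalIntegral.integral_const_mul]
    congr 1; ext x
    simp only [d, if_true]
    ring
  unfold FF
  have : t k * ∑ j, B k j * t j * I k j = ∑ j, B k j * I k j * t k * t j := by
    rw [Finset.mul_sum]; exact Finset.sum_congr rfl fun j _ => by ring
  rw [e1, e2, e3, e4, mul_sub, this]; ring

lemma el_eq [Nonempty ι] (B : ι → ι → ℝ) (hB : ∀ i j, B i j = B j i)
    (u : ι → ℝ × HH) (γ : ℝ) (hu : IsM B u γ)
    (hpd : ∀ x : ι → ℝ, x ≠ 0 → 0 < qf (MM B u) x)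
    (t : ι → ℝ) (ht : ∀ i, 0 ≤ t i) (htγ : FF (aa u) (MM B u) t = γ)
    (k : ι) (hk : t k ≠ 0) (w : ℝ × HH) :
    inner ℝ (u k).2 w.2 = ∫ x in (0:ℝ)..1, ff B u t k x * fn w x := by
  have h1 := el_ineq B hB u γ hu hpd t ht htγ k w
  have h2 := el_ineq B hB u γ hu hpd t ht htγ k ((-1:ℝ) • w)
  have hk' : 0 < t k := lt_of_le_of_ne (ht k) (Ne.symm hk)
  have e : ∫ x in (0:ℝ)..1, ff B u t k x * fn ((-1:ℝ) • w) x =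
      - ∫ x in (0:ℝ)..1, ff B u t k x * fn w x := by
    rw [← intervalIntegral.integral_neg]
    congr 1; ext x; rw [fn_smul]; ring
  rw [e] at h2
  simp only [Prod.smul_snd, inner_smul_right] at h2
  have h3 := nonneg_of_mul_nonneg_right h1 hk'
  have h4 := nonneg_of_mul_nonneg_right h2 hk'
  linarith

end Sol

namespace Sol
open Filter Topology MeasureTheory

lemma prim_deriv (f : ℝ → ℝ) (hf : Continuous f) (z : ℝ) :
    HasDerivAt (fun z => ∫ x in (0:ℝ)..z, f x) (f z) z :=
  (hf.integral_hasStrictDerivAt 0 z).hasDerivAt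

lemma prim_cont (f : ℝ → ℝ) (hf : Continuous f) : Continuous (fun z => ∫ x in (0:ℝ)..z, f x) :=
  continuous_iff_continuousAt.mpr fun z => (prim_deriv f hf z).continuousAt

noncomputable def PP (f : ℝ → ℝ) (z : ℝ) : ℝ := - ∫ x in (0:ℝ)..z, f x

lemma PP_deriv (f : ℝ → ℝ) (hf : Continuous f) (z : ℝ) : HasDerivAt (PP f) (- f z) z :=
  (prim_deriv f hf z).neg

lemma PP_cont (f : ℝ → ℝ) (hf : Continuous f) : Continuous (PP f) := (prim_cont f hf).neg

lemma PP_zero (f : ℝ → ℝ) : PP f 0 = 0 := by simp [PP]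

lemma regularity (w : ℝ × HH) (f : ℝ → ℝ) (hf : Continuous f)
    (hel : ∀ v : ℝ × HH, inner ℝ w.2 v.2 = ∫ x in (0:ℝ)..1, f x * fn v x) :
    PP f 1 = 0 ∧ (∀ z ∈ Set.Icc (0:ℝ) 1, fn w z = w.1 + ∫ x in (0:ℝ)..z, PP f x) ∧
    ‖w.2‖ ^ 2 = ∫ x in (0:ℝ)..1, PP f x ^ 2 := by
  have hP := PP_cont f hf
  have h1 : PP f 1 = 0 := by
    have := hel (1, 0)
    simp [fn] at this
    simp [PP, ← this]
  have h2 : ∀ z ∈ Set.Icc (0:ℝ) 1, fn w z = w.1 + ∫ x in (0:ℝ)..z, PP f x := by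
    intro z hz
    have h3 := hel (0, ee z)
    simp only [fn, zero_add, inner_ee] at h3
    unfold fn
    rw [real_inner_comm, h3]
    congr 1
    have hcl : Continuous cl := by unfold cl; fun_prop
    have hint : ∀ a b, IntervalIntegrable (fun x => f x * cl (min x z)) volume a b := fun a b =>
      Continuous.intervalIntegrable (by fun_prop) _ _
    rw [← intervalIntegral.integral_add_adjacent_intervals (hint 0 z) (hint z 1)]
    have e1 : ∫ x in (0:ℝ)..z, f x * cl (min x z) = ∫ x in (0:ℝ)..z, x * f x := by
      apply intervalIntegral.integral_congr
      intro x hx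
      rw [Set.uIcc_of_le hz.1] at hx
      simp only
      rw [min_eq_left hx.2, cl_of_mem ⟨hx.1, hx.2.trans hz.2⟩, mul_comm]
    have e2 : ∫ x in z..1, f x * cl (min x z) = z * ∫ x in z..1, f x := by
      rw [← intervalIntegral.integral_const_mul]
      apply intervalIntegral.integral_congr
      intro x hx
      rw [Set.uIcc_of_le hz.2] at hx
      simp only
      rw [min_eq_right hx.1, cl_of_mem hz, mul_comm]
    have e3 : ∫ x in z..1, f x = PP f z := by
      have := intervalIntegral.integral_add_adjacent_intervals
        (hf.intervalIntegrable 0 z : IntervalIntegrable f volume 0 z) (hf.intervalIntegrable z 1)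
      unfold PP at h1 ⊢
      linarith
    have e4 := intervalIntegral.integral_mul_deriv_eq_deriv_mul (a := 0) (b := z)
      (u := fun x => x) (v := PP f) (u' := fun _ => 1) (v' := fun x => - f x)
      (fun x _ => hasDerivAt_id x) (fun x _ => PP_deriv f hf x)
      (continuous_const.intervalIntegrable _ _) (hf.neg.intervalIntegrable _ _)
    simp only [one_mul, zero_mul, sub_zero, mul_neg, intervalIntegral.integral_neg] at e4
    rw [e1, e2, e3]
    linarith
  refine ⟨h1, h2, ?_⟩
  have h3 := hel w
  rw [real_inner_self_eq_norm_sq] at h3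
  rw [h3]
  have e1 : ∫ x in (0:ℝ)..1, f x * fn w x =
      ∫ x in (0:ℝ)..1, (w.1 + ∫ y in (0:ℝ)..x, PP f y) * f x := by
    apply intervalIntegral.integral_congr
    intro x hx
    rw [Set.uIcc_of_le zero_le_one] at hx
    simp only
    rw [h2 x hx, mul_comm]
  rw [e1]
  have e4 := intervalIntegral.integral_mul_deriv_eq_deriv_mul (a := 0) (b := 1)
      (u := fun x => w.1 + ∫ y in (0:ℝ)..x, PP f y) (v := PP f) (u' := PP f) (v' := fun x => - f x)
      (fun x _ => (prim_deriv _ hP x).const_add _) (fun x _ => PP_deriv f hf x)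
      (hP.intervalIntegrable _ _) (hf.neg.intervalIntegrable _ _)
  simp only [h1, PP_zero, mul_zero, sub_zero, mul_neg, intervalIntegral.integral_neg] at e4
  have e5 : ∀ x, PP f x ^ 2 = PP f x * PP f x := fun x => by ring
  simp only [e5]
  linarith

lemma abs_repr (s : ℝ) (P : ℝ → ℝ) (hP : Continuous P) :
    ∃ w : ℝ × HH, (∀ z ∈ Set.Icc (0:ℝ) 1, fn w z = |s + ∫ x in (0:ℝ)..z, P x|) ∧
      ‖w.2‖ ^ 2 ≤ ∫ x in (0:ℝ)..1, P x ^ 2 := by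
  set u : ℝ → ℝ := fun z => s + ∫ x in (0:ℝ)..z, P x with hu
  have hud : ∀ z, HasDerivAt u (P z) z := fun z => (prim_deriv P hP z).const_add s
  have huc : Continuous u := continuous_iff_continuousAt.mpr fun z => (hud z).continuousAt
  let p : ℝ → ℝ := fun x => u x / |u x| * P x
  have hp : Measurable p := by
    have := huc.measurable
    have h2 := huc.abs.measurable
    have h3 := hP.measurable
    fun_prop
  have hle : ∀ x, |p x| ≤ |P x| := by
    intro x
    simp only [p, abs_mul, abs_div, abs_abs]
    exact mul_le_of_le_one_left (abs_nonneg _) (div_self_le_one _)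
  obtain ⟨C, hC⟩ := (isCompact_Icc (a := (0:ℝ)) (b := 1)).exists_bound_of_continuousOn
    hP.continuousOn
  obtain ⟨g, hg, hgn⟩ := exists_repr p hp C
    (fun x hx => (hle x).trans (hC x ⟨hx.1.le, hx.2⟩))
  refine ⟨(|s|, g), fun z hz => ?_, ?_⟩
  · unfold fn
    simp only
    rw [hg z hz]
    have key : ∀ ε : ℝ, 0 < ε → √(u z ^ 2 + ε ^ 2) = √(s ^ 2 + ε ^ 2) +
        ∫ x in (0:ℝ)..z, u x / √(u x ^ 2 + ε ^ 2) * P x := by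
      intro ε hε
      have hne : ∀ x, u x ^ 2 + ε ^ 2 ≠ 0 := fun x => by positivity
      have hne2 : ∀ x, √(u x ^ 2 + ε ^ 2) ≠ 0 := fun x => by positivity
      have hc : Continuous fun x => u x / √(u x ^ 2 + ε ^ 2) * P x := by fun_prop (disch := assumption)
      have := intervalIntegral.integral_eq_sub_of_hasDerivAt (a := 0) (b := z)
        (f := fun x => √(u x ^ 2 + ε ^ 2)) (f' := fun x => u x / √(u x ^ 2 + ε ^ 2) * P x)
        (by
          intro x _
          have h1 := (((hud x).pow 2).add_const (ε ^ 2)).sqrt (hne x)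
          refine h1.congr_deriv ?_
          have := hne2 x
          simp only [Pi.pow_apply]
          field_simp
          norm_num; ring)
        (hc.intervalIntegrable _ _)
      rw [this]
      simp [hu]
    have t1 : Tendsto (fun ε : ℝ => √(u z ^ 2 + ε ^ 2)) (𝓝[>] 0) (𝓝 |u z|) := by
      have : Continuous (fun ε : ℝ => √(u z ^ 2 + ε ^ 2)) := by fun_prop
      have h := (this.tendsto 0).mono_left (nhdsWithin_le_nhds (s := Set.Ioi 0))
      simpa [Real.sqrt_sq_eq_abs] using h
    have t2 : Tendsto (fun ε : ℝ => √(s ^ 2 + ε ^ 2)) (𝓝[>] 0) (𝓝 |s|) := by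
      have : Continuous (fun ε : ℝ => √(s ^ 2 + ε ^ 2)) := by fun_prop
      have h := (this.tendsto 0).mono_left (nhdsWithin_le_nhds (s := Set.Ioi 0))
      simpa [Real.sqrt_sq_eq_abs] using h
    have t3 : Tendsto (fun ε : ℝ => ∫ x in (0:ℝ)..z, u x / √(u x ^ 2 + ε ^ 2) * P x) (𝓝[>] 0)
        (𝓝 (∫ x in (0:ℝ)..z, p x)) := by
      apply intervalIntegral.tendsto_integral_filter_of_dominated_convergence (fun x => |P x|)
      · refine Eventually.of_forall fun ε => ?_
        have := huc.measurable
        have h3 := hP.measurable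
        apply Measurable.aestronglyMeasurable
        fun_prop
      · refine Eventually.of_forall fun ε => ?_
        refine Eventually.of_forall fun x _ => ?_
        rw [Real.norm_eq_abs, abs_mul, abs_div]
        refine mul_le_of_le_one_left (abs_nonneg _) (div_le_one_of_le₀ ?_ (abs_nonneg _))
        rw [abs_of_nonneg (Real.sqrt_nonneg _)]
        apply Real.abs_le_sqrt
        nlinarith
      · exact hP.abs.intervalIntegrable _ _
      · refine Eventually.of_forall fun x _ => ?_
        by_cases h0 : u x = 0
        · simp [p, h0]
        · have hz : |u x| ≠ 0 := by simpa using h0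
          have : ContinuousAt (fun ε : ℝ => u x / √(u x ^ 2 + ε ^ 2) * P x) 0 := by
            have : √(u x ^ 2 + 0 ^ 2) ≠ 0 := by simpa [Real.sqrt_sq_eq_abs] using h0
            fun_prop (disch := assumption)
          have h := (this.tendsto).mono_left (nhdsWithin_le_nhds (s := Set.Ioi 0))
          simpa [Real.sqrt_sq_eq_abs, p] using h
    have t4 := t2.add t3
    have t5 : Tendsto (fun ε : ℝ => √(u z ^ 2 + ε ^ 2)) (𝓝[>] 0)
        (𝓝 (|s| + ∫ x in (0:ℝ)..z, p x)) := by
      refine t4.congr' ?_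
      filter_upwards [self_mem_nhdsWithin] with ε hε
      exact (key ε hε).symm
    exact tendsto_nhds_unique t5 t1
  · simp only
    rw [hgn, intervalIntegral.integral_of_le zero_le_one, intervalIntegral.integral_of_le zero_le_one]
    apply integral_mono_of_nonneg
    · exact Eventually.of_forall fun x => sq_nonneg _
    · have : Continuous fun x => P x ^ 2 := by fun_prop
      have h := this.intervalIntegrable (μ := volume) 0 1
      exact (intervalIntegrable_iff_integrableOn_Ioc_of_le zero_le_one).mp h
    · exact Eventually.of_forall fun x => sq_le_sq.mpr (hle x)

end Sol

namespace Sol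
open Filter Topology MeasureTheory

variable {ι : Type} [Fintype ι]

lemma max_val [Nonempty ι] (B : ι → ι → ℝ)
    (u : ι → ℝ × HH) (γ : ℝ) (hu : IsM B u γ)
    (hpd : ∀ x : ι → ℝ, x ≠ 0 → 0 < qf (MM B u) x) :
    ∃ t : ι → ℝ, (∀ i, 0 ≤ t i) ∧ FF (aa u) (MM B u) t = γ := by
  obtain ⟨t, ht, hmax⟩ := exists_max (aa u) (MM B u) hpd
  refine ⟨t, ht, le_antisymm (hu.2.1 t ht) (hu.2.2 u _ (fun i => ?_) hmax)⟩
  rw [hu.1 i]; exact one_pos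

lemma nonneg_min [Nonempty ι] (B : ι → ι → ℝ) (hB : ∀ i j, B i j = B j i)
    (hmin : ∀ c : ι → ℝ, (∀ i, 0 ≤ c i) → c ≠ 0 → (∃ i, c i = 0) → 0 < qf B c)
    (c : ι → ℝ) (hc : ∀ i, 0 < c i) (hq : qf B c < 0) (hd : ∀ i, 0 < B i i) :
    ∃ (u : ι → ℝ × HH) (γ : ℝ) (t : ι → ℝ), IsM B u γ ∧ (∀ i, 0 ≤ t i) ∧
      FF (aa u) (MM B u) t = γ ∧ (∀ k, t k ≠ 0 → ∀ z ∈ Set.Icc (0:ℝ) 1, 0 ≤ fn (u k) z) ∧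
      (∃ k, t k ≠ 0) ∧ ∀ x : ι → ℝ, x ≠ 0 → 0 < qf (MM B u) x := by
  classical
  obtain ⟨u, γ, hu⟩ := exists_isM B hd
  have hpd := pd_lemma B hB hmin c hc hq u γ hu.1 hu.2.1
  obtain ⟨t, ht, htγ⟩ := max_val B u γ hu hpd
  have hw : ∀ k, ∃ w : ℝ × HH, (∀ z ∈ Set.Icc (0:ℝ) 1, fn w z ^ 2 = fn (u k) z ^ 2) ∧
      ‖w.2‖ ^ 2 ≤ ‖(u k).2‖ ^ 2 ∧ (t k ≠ 0 → ∀ z ∈ Set.Icc (0:ℝ) 1, 0 ≤ fn w z) := by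
    intro k
    by_cases hk : t k = 0
    · exact ⟨u k, fun _ _ => rfl, le_rfl, fun h => absurd hk h⟩
    · have hf := ff_cont B u t k
      obtain ⟨_, h2, h3⟩ := regularity (u k) (ff B u t k) hf
        (el_eq B hB u γ hu hpd t ht htγ k hk)
      obtain ⟨w, hw1, hw2⟩ := abs_repr (u k).1 _ (PP_cont _ hf)
      refine ⟨w, fun z hz => ?_, ?_, fun _ z hz => ?_⟩
      · rw [hw1 z hz, sq_abs, h2 z hz]
      · rw [h3]; exact hw2
      · rw [hw1 z hz]; exact abs_nonneg _
  choose w hw1 hw2 hw3 using hw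
  have hN : Nrm w := by
    intro i
    refine Eq.trans ?_ (hu.1 i)
    apply intervalIntegral.integral_congr
    intro z hz
    rw [Set.uIcc_of_le zero_le_one] at hz
    exact hw1 i z hz
  have hMM : MM B w = MM B u := by
    ext i j
    unfold MM
    congr 1
    apply intervalIntegral.integral_congr
    intro z hz
    rw [Set.uIcc_of_le zero_le_one] at hz
    simp only
    rw [hw1 i z hz, hw1 j z hz]
  have hle : ∀ s : ι → ℝ, (∀ i, 0 ≤ s i) → FF (aa w) (MM B w) s ≤ FF (aa u) (MM B u) s := by
    intro s hs
    rw [hMM]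
    unfold FF
    have : ∑ i, aa w i * s i ≤ ∑ i, aa u i * s i :=
      Finset.sum_le_sum fun i _ => mul_le_mul_of_nonneg_right (hw2 i) (hs i)
    linarith
  have hwM : IsM B w γ := ⟨hN, fun s hs => (hle s hs).trans (hu.2.1 s hs), hu.2.2⟩
  have hpd' : ∀ x : ι → ℝ, x ≠ 0 → 0 < qf (MM B w) x := by rw [hMM]; exact hpd
  obtain ⟨t', ht', htγ'⟩ := max_val B w γ hwM hpd'
  obtain ⟨m, hm, hco⟩ := coercive _ hpd
  have hst := strong (aa u) (MM B u) (MM_symm B hB u) m hco hm t ht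
    (by rw [htγ]; exact hu.2.1) t' ht'
  have h5 := hle t' ht'
  rw [htγ'] at h5
  rw [htγ] at hst
  have h6 : ‖fun i => t' i - t i‖ ^ 2 = 0 := by
    have h7 : 0 ≤ ‖fun i => t' i - t i‖ ^ 2 := sq_nonneg _
    by_contra hne
    have h8 : 0 < m / 4 * ‖fun i => t' i - t i‖ ^ 2 :=
      mul_pos (by positivity) (lt_of_le_of_ne h7 (Ne.symm hne))
    linarith
  have h7 : t' = t := by
    have h8 : (fun i => t' i - t i) = 0 := by
      rw [← norm_eq_zero]; exact pow_eq_zero_iff (two_ne_zero) |>.mp h6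
    ext i
    have := congrFun h8 i
    simp only [Pi.zero_apply] at this
    linarith
  rw [h7] at htγ'
  refine ⟨w, γ, t, hwM, ht, htγ', hw3, ?_, hpd'⟩
  by_contra hno
  push Not at hno
  have ht0 : t = 0 := funext hno
  have hγ : γ = 0 := by rw [← htγ, ht0]; simp [FF, qf]
  refine not_const B c hc hq w γ hN hwM.2.1 fun i => const_of_le w i ?_
  by_contra hpos
  push Not at hpos
  set q := MM B w i i with hqd
  have hqpos : 0 < q := by
    have h1 := hpd' (Pi.single i 1) (by simp)
    have h2 : qf (MM B w) (Pi.single i 1) = q := by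
      unfold qf
      rw [Finset.sum_eq_single i, Finset.sum_eq_single i]
      · simp [hqd]
      · intro j _ hj; simp [hj]
      · simp
      · intro j _ hj; simp [hj]
      · simp
    rwa [h2] at h1
  have h1 := hwM.2.1 (fun j => (aa w i / q) * (Pi.single i 1 : ι → ℝ) j) (fun j => by
    by_cases h : j = i
    · subst h; simp; positivity
    · simp [h])
  rw [FF_smul, hγ] at h1
  have h2 : qf (MM B w) (Pi.single i 1) = q := by
    unfold qf
    rw [Finset.sum_eq_single i, Finset.sum_eq_single i]
    · simp [hqd]
    · intro j _ hj; simp [hj]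
    · simp
    · intro j _ hj; simp [hj]
    · simp
  have h3 : ∑ j, aa w j * (Pi.single i 1 : ι → ℝ) j = aa w i := by
    rw [Finset.sum_eq_single i]
    · simp
    · intro j _ hj; simp [hj]
    · simp
  rw [h2, h3] at h1
  have h4 : aa w i / q * (1 / 2 * aa w i) - (aa w i / q) ^ 2 * (1 / 4 * q) =
    1 / 4 * (aa w i ^ 2 / q) := by field_simp; norm_num
  rw [h4] at h1
  have : 0 < aa w i ^ 2 / q := by positivity
  linarith

lemma var_sol [Nonempty ι] (B : ι → ι → ℝ) (hB : ∀ i j, B i j = B j i)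
    (hmin : ∀ c : ι → ℝ, (∀ i, 0 ≤ c i) → c ≠ 0 → (∃ i, c i = 0) → 0 < qf B c)
    (c : ι → ℝ) (hc : ∀ i, 0 < c i) (hq : qf B c < 0) (hd : ∀ i, 0 < B i i) :
    ∃ v : ι → ℝ → ℝ, (∀ k, Continuous (v k)) ∧
      (∀ k, PP (fun x => ∑ j, B k j * v j x ^ 2 * v k x) 1 = 0) ∧
      (∀ k, ∀ z ∈ Set.Icc (0:ℝ) 1, v k z = v k 0 +
        ∫ x in (0:ℝ)..z, PP (fun x => ∑ j, B k j * v j x ^ 2 * v k x) x) ∧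
      (∀ k, ∀ z ∈ Set.Icc (0:ℝ) 1, 0 ≤ v k z) ∧ ∃ k, ∃ z ∈ Set.Icc (0:ℝ) 1, v k z ≠ 0 := by
  obtain ⟨u, γ, t, hu, ht, htγ, hpos, ⟨k0, hk0⟩, hpd⟩ := nonneg_min B hB hmin c hc hq hd
  have hφ : ∀ k, (fun x => ∑ j, B k j * (√(t j) * fn (u j) x) ^ 2 * (√(t k) * fn (u k) x)) =
      fun x => √(t k) * ff B u t k x := by
    intro k
    ext x
    unfold ff
    rw [Finset.mul_sum]
    refine Finset.sum_congr rfl fun j _ => ?_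
    rw [mul_pow, Real.sq_sqrt (ht j)]
    ring
  have hPP : ∀ k, PP (fun x => √(t k) * ff B u t k x) = fun z => √(t k) * PP (ff B u t k) z := by
    intro k
    ext z
    unfold PP
    rw [intervalIntegral.integral_const_mul]; ring
  have hreg : ∀ k, t k ≠ 0 → _ := fun k hk => regularity (u k) (ff B u t k) (ff_cont B u t k)
        (el_eq B hB u γ hu hpd t ht htγ k hk)
  refine ⟨fun k x => √(t k) * fn (u k) x, fun k => ?_, fun k => ?_, fun k z hz => ?_,
    fun k z hz => ?_, k0, ?_⟩
  · have := fn_cont (u k)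
    fun_prop
  · simp only
    rw [hφ, hPP]
    by_cases hk : t k = 0
    · simp [hk]
    · simp [(hreg k hk).1]
  · simp only
    rw [hφ, hPP]
    by_cases hk : t k = 0
    · simp [hk]
    · rw [intervalIntegral.integral_const_mul, (hreg k hk).2.1 z hz, fn_zero]; ring
  · by_cases hk : t k = 0
    · simp [hk]
    · exact mul_nonneg (Real.sqrt_nonneg _) (hpos k hk z hz)
  · by_contra hno
    push Not at hno
    have hs : √(t k0) ≠ 0 := by
      rw [Real.sqrt_ne_zero (ht k0)]; exact hk0
    have h1 := hu.1 k0
    have h2 : ∫ s in (0:ℝ)..1, fn (u k0) s ^ 2 = ∫ s in (0:ℝ)..1, (0:ℝ) := by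
      apply intervalIntegral.integral_congr
      intro s hss
      rw [Set.uIcc_of_le zero_le_one] at hss
      have := hno s hss
      simp only [mul_eq_zero, hs, false_or] at this
      simp [this]
    rw [h1] at h2
    simp at h2

end Sol

namespace Sol
open Filter Topology MeasureTheory

variable {ι : Type} [Fintype ι]

lemma prim_per (h : ℝ → ℝ) (hc : Continuous h) (hp : ∀ x, h (x + 2) = h x)
    (h0 : ∫ x in (-1:ℝ)..1, h x = 0) (x : ℝ) :
    ∫ y in (0:ℝ)..(x + 2), h y = ∫ y in (0:ℝ)..x, h y := by
  have hi : ∀ a b, IntervalIntegrable h volume a b := fun a b => hc.intervalIntegrable a b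
  rw [← intervalIntegral.integral_add_adjacent_intervals (hi 0 x) (hi x (x + 2))]
  have := Function.Periodic.intervalIntegral_add_eq (f := h) (T := 2) hp x (-1)
  rw [this]
  norm_num [h0]

lemma prim_neg (h : ℝ → ℝ) (x : ℝ) :
    ∫ y in (0:ℝ)..(-x), h y = - ∫ y in (0:ℝ)..x, h (-y) := by
  rw [intervalIntegral.integral_comp_neg, neg_zero, ← intervalIntegral.integral_symm]

lemma even_per (g : ℝ → ℝ) (hc : Continuous g) (hp : ∀ x, g (x + 2) = g x)
    (he : ∀ x, g (-x) = g x) (h0 : PP g 1 = 0) :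
    (∀ x, ∫ y in (0:ℝ)..(x + 2), PP g y = ∫ y in (0:ℝ)..x, PP g y) ∧
    (∀ x, ∫ y in (0:ℝ)..(-x), PP g y = ∫ y in (0:ℝ)..x, PP g y) := by
  have hPc := PP_cont g hc
  have hodd : ∀ x, PP g (-x) = - PP g x := by
    intro x
    unfold PP
    rw [prim_neg]
    simp only [he]
  have hsplit : ∀ h : ℝ → ℝ, Continuous h → ∫ x in (-1:ℝ)..1, h x =
      (∫ y in (0:ℝ)..1, h (-y)) + ∫ y in (0:ℝ)..1, h y := by
    intro h hh
    rw [← intervalIntegral.integral_add_adjacent_intervals (b := 0) (hh.intervalIntegrable _ _)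
      (hh.intervalIntegrable _ _)]
    rw [intervalIntegral.integral_comp_neg, neg_zero]
  have h1 : ∫ y in (0:ℝ)..1, g y = 0 := by unfold PP at h0; linarith
  have hper : ∀ x, PP g (x + 2) = PP g x := by
    intro x
    unfold PP
    rw [prim_per g hc hp]
    rw [hsplit g hc]
    simp only [he, h1, add_zero]
  refine ⟨prim_per _ hPc hper ?_, fun x => ?_⟩
  · rw [hsplit _ hPc]
    simp only [hodd, intervalIntegral.integral_neg]
    ring
  · rw [prim_neg]
    simp only [hodd, intervalIntegral.integral_neg, neg_neg]

noncomputable def tau (x : ℝ) : ℝ := Real.arccos (Real.cos (Real.pi * x)) / Real.pi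

lemma tau_cont : Continuous tau := by
  unfold tau
  have := Real.continuous_arccos
  have h2 := Real.continuous_cos
  exact (this.comp (h2.comp (continuous_const.mul continuous_id))).div_const _

lemma tau_mem (x : ℝ) : tau x ∈ Set.Icc (0:ℝ) 1 := by
  unfold tau
  exact ⟨div_nonneg (Real.arccos_nonneg _) Real.pi_pos.le,
    div_le_one_of_le₀ (Real.arccos_le_pi _) Real.pi_pos.le⟩

lemma tau_of_mem {x : ℝ} (hx : x ∈ Set.Icc (0:ℝ) 1) : tau x = x := by
  unfold tau
  have := Real.pi_pos
  rw [Real.arccos_cos (mul_nonneg this.le hx.1) (by nlinarith [hx.2])]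
  field_simp

lemma tau_neg (x : ℝ) : tau (-x) = tau x := by
  unfold tau; rw [mul_neg, Real.cos_neg]

lemma tau_per (x : ℝ) : tau (x + 2) = tau x := by
  unfold tau
  rw [mul_add, mul_comm Real.pi 2, Real.cos_add_two_pi]

lemma eq_tau (W : ℝ → ℝ) (hp : ∀ x, W (x + 2) = W x) (he : ∀ x, W (-x) = W x) (x : ℝ) :
    W x = W (tau x) := by
  have hpi := Real.pi_pos
  have h1 : Real.cos (Real.pi * x) = Real.cos (Real.pi * tau x) := by
    have : Real.pi * tau x = Real.arccos (Real.cos (Real.pi * x)) := by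
      unfold tau; field_simp
    rw [this, Real.cos_arccos (Real.neg_one_le_cos _) (Real.cos_le_one _)]
  obtain ⟨k, hk⟩ := Real.cos_eq_cos_iff.mp h1
  have hper : Function.Periodic W 2 := hp
  have hz := hper.int_mul k
  rcases hk with hk | hk
  · have : tau x = x + k * 2 := by
      apply mul_left_cancel₀ hpi.ne'
      linarith
    rw [this]; exact (hz x).symm
  · have : tau x = -x + k * 2 := by
      apply mul_left_cancel₀ hpi.ne'
      linarith
    rw [this, hz (-x), he]

lemma line_sol (B : ι → ι → ℝ) (v : ι → ℝ → ℝ) (hv : ∀ k, Continuous (v k))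
    (h1 : ∀ k, PP (fun x => ∑ j, B k j * v j x ^ 2 * v k x) 1 = 0)
    (h2 : ∀ k, ∀ z ∈ Set.Icc (0:ℝ) 1, v k z = v k 0 +
        ∫ x in (0:ℝ)..z, PP (fun x => ∑ j, B k j * v j x ^ 2 * v k x) x)
    (h3 : ∀ k, ∀ z ∈ Set.Icc (0:ℝ) 1, 0 ≤ v k z)
    (h4 : ∃ k, ∃ z ∈ Set.Icc (0:ℝ) 1, v k z ≠ 0) :
    ∃ W W' : ι → ℝ → ℝ, (∀ k x, HasDerivAt (W k) (W' k x) x) ∧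
      (∀ k x, HasDerivAt (W' k) (- ∑ j, B k j * W j x ^ 2 * W k x) x) ∧
      (∀ k x, 0 ≤ W k x) ∧ ∃ k, W k ≠ 0 := by
  let w : ι → ℝ → ℝ := fun k x => v k (tau x)
  have hw : ∀ k, Continuous (w k) := fun k => (hv k).comp tau_cont
  let φ : ι → ℝ → ℝ := fun k x => ∑ j, B k j * w j x ^ 2 * w k x
  have hφ : ∀ k, Continuous (φ k) := fun k => by simp only [φ]; fun_prop
  have hPP : ∀ k, ∀ z ∈ Set.Icc (0:ℝ) 1,
      PP (fun x => ∑ j, B k j * v j x ^ 2 * v k x) z = PP (φ k) z := by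
    intro k z hz
    unfold PP
    congr 1
    apply intervalIntegral.integral_congr
    intro x hx
    rw [Set.uIcc_of_le hz.1] at hx
    simp only [φ, w]
    rw [tau_of_mem ⟨hx.1, hx.2.trans hz.2⟩]
  let W : ι → ℝ → ℝ := fun k x => v k 0 + ∫ y in (0:ℝ)..x, PP (φ k) y
  have hWv : ∀ k, ∀ z ∈ Set.Icc (0:ℝ) 1, W k z = v k z := by
    intro k z hz
    rw [h2 k z hz]
    simp only [W]
    congr 1
    apply intervalIntegral.integral_congr
    intro x hx
    rw [Set.uIcc_of_le hz.1] at hx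
    exact (hPP k x ⟨hx.1, hx.2.trans hz.2⟩).symm
  have hep := fun k => even_per (φ k) (hφ k) (fun x => by simp only [φ, w, tau_per])
    (fun x => by simp only [φ, w, tau_neg])
    (by rw [← hPP k 1 ⟨zero_le_one, le_rfl⟩]; exact h1 k)
  have hWw : ∀ k x, W k x = w k x := by
    intro k x
    rw [eq_tau (W k) (fun x => by simp only [W]; rw [(hep k).1])
      (fun x => by simp only [W]; rw [(hep k).2]) x]
    exact hWv k _ (tau_mem x)
  refine ⟨W, fun k => PP (φ k), fun k x => (prim_deriv _ (PP_cont _ (hφ k)) x).const_add _,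
    fun k x => ?_, fun k x => ?_, ?_⟩
  · simp only [hWw]
    exact PP_deriv (φ k) (hφ k) x
  · rw [hWw]; exact h3 k _ (tau_mem x)
  · obtain ⟨k, z, hz, hne⟩ := h4
    refine ⟨k, fun h => hne ?_⟩
    rw [← hWv k z hz, h]; rfl

/-- Any matrix reduction to one space dimension. -/
lemma core [Nonempty ι] (B : ι → ι → ℝ) (hB : ∀ i j, B i j = B j i) (hdiag : ∀ i, 0 ≤ B i i)
    (hmin : ∀ c : ι → ℝ, (∀ i, 0 ≤ c i) → c ≠ 0 → (∃ i, c i = 0) → 0 < qf B c)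
    (c : ι → ℝ) (hc : ∀ i, 0 < c i) (hq : qf B c ≤ 0) :
    ∃ W W' : ι → ℝ → ℝ, (∀ k x, HasDerivAt (W k) (W' k x) x) ∧
      (∀ k x, HasDerivAt (W' k) (- ∑ j, B k j * W j x ^ 2 * W k x) x) ∧
      (∀ k x, 0 ≤ W k x) ∧ ∃ k, W k ≠ 0 := by
  classical
  have hsingle : ∀ (x : ι → ℝ) i, bf B x (Pi.single i 1) = ∑ j, B i j * x j := by
    intro x i
    unfold bf
    refine Finset.sum_congr rfl fun j _ => ?_
    rw [Finset.sum_eq_single i]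
    · simp [hB j i]
    · intro k _ hk; simp [hk]
    · simp
  have hqs : ∀ i, qf B (Pi.single i 1) = B i i := by
    intro i
    have : qf B (Pi.single i 1) = bf B (Pi.single i 1) (Pi.single i 1) := rfl
    rw [this, hsingle, Finset.sum_eq_single i]
    · simp
    · intro k _ hk; simp [hk]
    · simp
  by_cases hneg : ∃ d : ι → ℝ, (∀ i, 0 < d i) ∧ qf B d < 0
  · obtain ⟨d, hd, hqd⟩ := hneg
    have hdi : ∀ i, 0 < B i i := by
      intro i
      by_cases h : ∃ j, j ≠ i
      · obtain ⟨j, hj⟩ := h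
        rw [← hqs i]
        refine hmin _ (fun k => ?_) (by simp) ⟨j, by simp [hj]⟩
        by_cases hk : k = i
        · subst hk; simp
        · simp [hk]
      · push Not at h
        exfalso
        have : 0 ≤ qf B d := by
          unfold qf
          refine Finset.sum_nonneg fun a _ => Finset.sum_nonneg fun b _ => ?_
          rw [h a, h b]
          exact mul_nonneg (mul_nonneg (hdiag i) (hd i).le) (hd i).le
        linarith
    obtain ⟨v, a1, a2, a3, a4, a5⟩ := var_sol B hB hmin d hd hqd hdi
    exact line_sol B v a1 a2 a3 a4 a5
  · push Not at hneg
    have hq0 : qf B c = 0 := le_antisymm hq (hneg c hc)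
    have hBc : ∀ i, ∑ j, B i j * c j = 0 := by
      intro i
      rw [← hsingle]
      have hder : ∀ s : ℝ, |s| < c i →
          0 ≤ 2 * s * bf B c (Pi.single i 1) + s ^ 2 * B i i := by
        intro s hs
        have h1 := hneg (fun j => c j + s * (Pi.single i 1 : ι → ℝ) j) (fun j => by
          by_cases hj : j = i
          · subst hj; simp; linarith [(abs_lt.mp hs).1]
          · simp [hj, hc j])
        rw [qf_add B hB, hq0, hqs] at h1
        linarith
      set b := bf B c (Pi.single i 1) with hb
      by_contra hne
      have hb2 : 0 < |b| := abs_pos.mpr hne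
      have hB1 : 0 < B i i + 1 := by linarith [hdiag i]
      obtain ⟨r, hr0, hr⟩ := exists_between (lt_min (hc i) (div_pos hb2 hB1))
      have hr1 := lt_of_lt_of_le hr (min_le_left _ _)
      have hr2 := lt_of_lt_of_le hr (min_le_right _ _)
      rw [lt_div_iff₀ hB1] at hr2
      have hrB : r * B i i < |b| := by nlinarith
      rcases lt_or_gt_of_ne hne with hl | hl
      · have := hder r (by rwa [abs_of_pos hr0])
        rw [abs_of_neg hl] at hrB
        nlinarith
      · have := hder (-r) (by rwa [abs_neg, abs_of_pos hr0])
        rw [abs_of_pos hl] at hrB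
        nlinarith
    refine ⟨fun k _ => √(c k), fun _ _ => 0, fun k x => hasDerivAt_const _ _, fun k x => ?_,
      fun k x => Real.sqrt_nonneg _, ?_⟩
    · have : ∑ j, B k j * √(c j) ^ 2 * √(c k) = 0 := by
        have e : ∀ j, B k j * √(c j) ^ 2 * √(c k) = B k j * c j * √(c k) := fun j => by
          rw [Real.sq_sqrt (hc j).le]
        simp only [e]
        rw [← Finset.sum_mul, hBc, zero_mul]
      simp only [this, neg_zero]
      exact hasDerivAt_const _ _
    · obtain ⟨k⟩ := ‹Nonempty ι›
      refine ⟨k, fun h => ?_⟩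
      have := congrFun h 0
      simp only [Pi.zero_apply] at this
      exact (Real.sqrt_ne_zero'.mpr (hc k)) this

end Sol

namespace Sol
open Filter Topology MeasureTheory

lemma lift_deriv {N : ℕ} (k : Fin N) (W : ℝ → ℝ) (W' : ℝ) (x : Fin N → ℝ)
    (h : HasDerivAt W W' (x k)) (v : Fin N → ℝ) :
    fderiv ℝ (fun y : Fin N → ℝ => W (y k)) x v = W' * v k := by
  have h1 : HasFDerivAt (fun y : Fin N → ℝ => y k) (ContinuousLinearMap.proj k) x :=
    (ContinuousLinearMap.proj (R := ℝ) (φ := fun _ : Fin N => ℝ) k).hasFDerivAt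
  have h2 := h.comp_hasFDerivAt x h1
  have h3 : HasFDerivAt (fun y : Fin N → ℝ => W (y k))
      (W' • (ContinuousLinearMap.proj k : (Fin N → ℝ) →L[ℝ] ℝ)) x := h2
  rw [h3.fderiv]
  simp

lemma lift_laplacian {N : ℕ} (k : Fin N) (W W' W'' : ℝ → ℝ) (h1 : ∀ x, HasDerivAt W (W' x) x)
    (h2 : ∀ x, HasDerivAt W' (W'' x) x) (x : Fin N → ℝ) :
    laplacian (fun y : Fin N → ℝ => W (y k)) x = W'' (x k) := by
  unfold laplacian
  have e : ∀ i : Fin N, (fun y => fderiv ℝ (fun y : Fin N → ℝ => W (y k)) y (Pi.single i 1)) =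
      fun y => (fun s => W' s * (Pi.single i (1:ℝ) : Fin N → ℝ) k) (y k) := by
    intro i
    ext y
    rw [lift_deriv k W _ y (h1 _)]
  simp only [e]
  have e2 : ∀ i : Fin N, fderiv ℝ (fun y : Fin N → ℝ =>
      (fun s => W' s * (Pi.single i (1:ℝ) : Fin N → ℝ) k) (y k)) x (Pi.single i 1) =
      W'' (x k) * (Pi.single i (1:ℝ) : Fin N → ℝ) k * (Pi.single i (1:ℝ) : Fin N → ℝ) k := by
    intro i
    rw [lift_deriv k _ _ x ((h2 (x k)).mul_const _)]
  rw [Finset.sum_congr rfl fun i _ => e2 i]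
  rw [Finset.sum_eq_single k]
  · simp
  · intro i _ hi; simp [Ne.symm hi]
  · simp

lemma c2_of (W W' W'' : ℝ → ℝ) (h1 : ∀ x, HasDerivAt W (W' x) x)
    (h2 : ∀ x, HasDerivAt W' (W'' x) x) (h3 : Continuous W'') : ContDiff ℝ 2 W := by
  have d1 : deriv W = W' := funext fun x => (h1 x).deriv
  have d2 : deriv W' = W'' := funext fun x => (h2 x).deriv
  have c1 : ContDiff ℝ 1 W' := by
    rw [contDiff_one_iff_deriv, d2]
    exact ⟨fun x => (h2 x).differentiableAt, h3⟩
  have : ContDiff ℝ (1 + 1) W := by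
    rw [contDiff_succ_iff_deriv, d1]
    exact ⟨fun x => (h1 x).differentiableAt, by simp, c1⟩
  have e : (1 + 1 : WithTop ℕ∞) = 2 := by norm_num
  rwa [e] at this

lemma sum_sub {n : ℕ} (p : Fin n → Prop) [DecidablePred p] (f : Fin n → ℝ)
    (hf : ∀ i, ¬ p i → f i = 0) : ∑ i, f i = ∑ i : {i // p i}, f i := by
  rw [← Fintype.sum_subtype_add_sum_subtype p f]
  have : ∑ i : {i // ¬ p i}, f i = 0 := Finset.sum_eq_zero fun i _ => hf i i.2
  rw [this, add_zero]

lemma line_main (n : ℕ) (B : Fin n → Fin n → ℝ) (hBs : ∀ i j, B i j = B j i)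
    (hdiag : ∀ i, 0 ≤ B i i)
    (hncop : ¬ (∀ c : Fin n → ℝ, (∀ i, 0 ≤ c i) → c ≠ 0 →
      0 < ∑ i, ∑ j, B i j * c i * c j)) :
    ∃ W W' : Fin n → ℝ → ℝ, (∀ k x, HasDerivAt (W k) (W' k x) x) ∧
      (∀ k x, HasDerivAt (W' k) (- ∑ j, B k j * W j x ^ 2 * W k x) x) ∧
      (∀ k x, 0 ≤ W k x) ∧ ∃ k, W k ≠ 0 := by
  classical
  push Not at hncop
  let supp : (Fin n → ℝ) → Finset (Fin n) := fun c => Finset.univ.filter fun i => c i ≠ 0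
  let bad : Set (Fin n → ℝ) := {c | (∀ i, 0 ≤ c i) ∧ c ≠ 0 ∧ ∑ i, ∑ j, B i j * c i * c j ≤ 0}
  have hbad : bad.Nonempty := by
    obtain ⟨c, h1, h2, h3⟩ := hncop
    exact ⟨c, h1, h2, h3⟩
  obtain ⟨c, ⟨hc0, hcne, hcq⟩, hcmin⟩ :=
    (measure (fun c : Fin n → ℝ => (supp c).card)).wf.has_min bad hbad
  obtain ⟨p, hp⟩ : ∃ p : Fin n → Prop, ∀ i, p i ↔ c i ≠ 0 := ⟨_, fun i => Iff.rfl⟩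
  obtain ⟨ext, hext1, hext0⟩ : ∃ ext : ({i // p i} → ℝ) → Fin n → ℝ,
      (∀ d (i : {i // p i}), ext d i = d i) ∧ ∀ d i, ¬ p i → ext d i = 0 :=
    ⟨fun d i => if h : p i then d ⟨i, h⟩ else 0, fun d i => dif_pos i.2, fun d i h => dif_neg h⟩
  let B' : {i // p i} → {i // p i} → ℝ := fun i j => B i j
  have hqf : ∀ x : Fin n → ℝ, (∀ i, ¬ p i → x i = 0) →
      ∑ i, ∑ j, B i j * x i * x j = qf B' (fun i => x i) := by
    intro x hx
    unfold qf
    rw [sum_sub p]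
    · refine Finset.sum_congr rfl fun i _ => ?_
      rw [sum_sub p]
      intro j hj
      rw [hx j hj, mul_zero]
    · intro i hi
      exact Finset.sum_eq_zero fun j _ => by rw [hx i hi]; ring
  have hne : Nonempty {i // p i} := by
    obtain ⟨i, hi⟩ := Function.ne_iff.mp hcne
    exact ⟨⟨i, (hp i).mpr hi⟩⟩
  obtain ⟨W, W', h1, h2, h3, k, h4⟩ := core B' (fun i j => hBs i j) (fun i => hdiag i)
    (by
      intro d hd0 hdne ⟨i0, hi0⟩
      by_contra hle
      push Not at hle
      refine hcmin (ext d) ⟨fun i => ?_, fun h => hdne ?_, ?_⟩ ?_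
      · by_cases h : p i
        · rw [hext1 d ⟨i, h⟩]; exact hd0 _
        · rw [hext0 d i h]
      · funext i
        rw [← hext1 d i, h]; rfl
      · rw [hqf _ (hext0 d)]
        simp only [hext1]
        exact hle
      · change (supp (ext d)).card < (supp c).card
        apply Finset.card_lt_card
        rw [Finset.ssubset_iff_of_subset]
        · refine ⟨i0, ?_, ?_⟩
          · simp only [supp, Finset.mem_filter, Finset.mem_univ, true_and]; exact (hp _).mp i0.2
          · simp only [supp, Finset.mem_filter, Finset.mem_univ, true_and, not_not]
            rw [hext1, hi0]
        · intro i hi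
          simp only [supp, Finset.mem_filter, Finset.mem_univ, true_and] at hi ⊢
          by_contra hcon
          exact hi (hext0 d i (fun h => (hp i).mp h hcon)))
    (fun i => c i) (fun i => lt_of_le_of_ne (hc0 i) (Ne.symm ((hp _).mp i.2)))
    (by
      rw [← hqf c (fun i hi => not_not.mp (fun h => hi ((hp i).mpr h)))]
      exact hcq)
  have hW1 : ∀ i (h : p i) x, ext (fun k => W k x) i = W ⟨i, h⟩ x := fun i h x =>
    hext1 (fun k => W k x) ⟨i, h⟩
  refine ⟨fun i x => ext (fun k => W k x) i, fun i x => ext (fun k => W' k x) i,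
    fun i x => ?_, fun i x => ?_, fun i x => ?_, k, ?_⟩
  · by_cases h : p i
    · have e1 : (fun x => ext (fun k => W k x) i) = W ⟨i, h⟩ := funext fun y => hW1 i h y
      have e2 : ext (fun k => W' k x) i = W' ⟨i, h⟩ x := hext1 (fun k => W' k x) ⟨i, h⟩
      beta_reduce
      rw [e1, e2]
      exact h1 _ x
    · simp only [hext0 _ i h]
      exact hasDerivAt_const _ _
  · by_cases h : p i
    · have e : ∑ j, B i j * ext (fun k => W k x) j ^ 2 * ext (fun k => W k x) i =
          ∑ j, B' ⟨i, h⟩ j * W j x ^ 2 * W ⟨i, h⟩ x := by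
        rw [sum_sub p]
        · refine Finset.sum_congr rfl fun j _ => ?_
          rw [hext1, hW1 i h]
        · intro j hj
          rw [hext0 _ j hj]; ring
      simp only [e]
      have e2 : (fun x => ext (fun k => W' k x) i) = W' ⟨i, h⟩ := by
        funext y; exact hext1 (fun k => W' k y) ⟨i, h⟩
      rw [e2]
      exact h2 _ x
    · have e : ∑ j, B i j * ext (fun k => W k x) j ^ 2 * ext (fun k => W k x) i = 0 :=
        Finset.sum_eq_zero fun j _ => by rw [hext0 _ i h]; ring
      simp only [e, neg_zero]
      simp only [hext0 _ i h]
      exact hasDerivAt_const _ _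
  · by_cases h : p i
    · simp only [hW1 i h]; exact h3 _ _
    · simp only [hext0 _ i h]; exact le_rfl
  · intro h
    apply h4
    funext x
    have := congrFun h x
    simp only [hext1] at this
    exact this

end Sol

theorem stmt_0 (N n : ℕ) (hN1 : 1 ≤ N) (hN : N ≤ 3)
    (B : Matrix (Fin n) (Fin n) ℝ) (hsym : B.IsSymm)
    (hdiag : ∀ i, 0 ≤ B i i)
    (hncop : ¬ (∀ c : Fin n → ℝ, (∀ i, 0 ≤ c i) → c ≠ 0 →
      0 < ∑ i, ∑ j, B i j * c i * c j)) :
    ∃ u : Fin n → (Fin N → ℝ) → ℝ,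
      (∀ i, ContDiff ℝ 2 (u i)) ∧
      (∀ i x, 0 ≤ u i x) ∧
      (∀ i x, -laplacian (u i) x = ∑ j, B i j * (u j x) ^ 2 * u i x) ∧
      (∃ i, u i ≠ 0) := by
  obtain ⟨W, W', h1, h2, h3, k, h4⟩ := Sol.line_main n B (fun i j => (hsym.apply i j).symm) hdiag hncop
  have hWc : ∀ i, Continuous (W i) := fun i =>
    continuous_iff_continuousAt.mpr fun x => (h1 i x).continuousAt
  let z : Fin N := ⟨0, hN1⟩
  refine ⟨fun i x => W i (x z), fun i => ?_, fun i x => h3 i _, fun i x => ?_, k, fun h => h4 ?_⟩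
  · have hc := Sol.c2_of (W i) (W' i) _ (h1 i) (h2 i) (by fun_prop)
    exact hc.comp (contDiff_apply ℝ ℝ z)
  · rw [Sol.lift_laplacian z (W i) (W' i) _ (h1 i) (h2 i) x, neg_neg]
  · funext y
    exact congrFun h (fun _ => y)
end

section
/- Let N ≤ 3 and let B = (β_ij) be a symmetric n×n real matrix which is strictly cubically copositive. Then the system −Δu_i = ∑_{j=1}^n β_ij u_j² u_i (i = 1,…,n) does not admit a nontrivial solution on ℝ^N: if u₁,…,uₙ : ℝ^N → ℝ are twice continuously differentiable, nonnegative, and satisfy −Δu_i = ∑_{j=1}^n β_ij u_j² u_i on ℝ^N for every i, then u_i ≡ 0 for all i. -/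
open Finset

open MeasureTheory Metric

theorem aux_pd {N : ℕ} {k m : WithTop ℕ∞} {f : (Fin N → ℝ) → ℝ} (hf : ContDiff ℝ k f) (h : m + 1 ≤ k)
    (v : Fin N → ℝ) : ContDiff ℝ m (fun y => fderiv ℝ f y v) :=
  (hf.fderiv_right h).clm_apply contDiff_const

theorem aux_pd1 {N : ℕ} {f : (Fin N → ℝ) → ℝ} (hf : ContDiff ℝ 2 f)
    (v : Fin N → ℝ) : ContDiff ℝ 1 (fun y => fderiv ℝ f y v) :=
  aux_pd hf (by norm_num) v

theorem aux_pd0 {N : ℕ} {f : (Fin N → ℝ) → ℝ} (hf : ContDiff ℝ 1 f)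
    (v : Fin N → ℝ) : Continuous (fun y => fderiv ℝ f y v) :=
  (aux_pd (m := 0) hf (by norm_num) v).continuous

theorem aux_lap_cont {N : ℕ} {f : (Fin N → ℝ) → ℝ} (hf : ContDiff ℝ 2 f) :
    Continuous (laplacian f) := by
  unfold laplacian
  exact continuous_finsetSum _ fun i _ => aux_pd0 (aux_pd1 hf _) _

theorem aux_lap_sum {N n : ℕ} (μ : Fin n → ℝ) (u : Fin n → (Fin N → ℝ) → ℝ)
    (hu : ∀ i, ContDiff ℝ 2 (u i)) (x : Fin N → ℝ) :
    laplacian (fun x => ∑ i, μ i * u i x) x = ∑ i, μ i * laplacian (u i) x := by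
  unfold laplacian
  simp_rw [Finset.mul_sum]
  rw [Finset.sum_comm]
  refine Finset.sum_congr rfl fun k _ => ?_
  have h1 : (fun y => fderiv ℝ (fun x => ∑ i, μ i * u i x) y (Pi.single k 1))
      = fun y => ∑ i, μ i * fderiv ℝ (u i) y (Pi.single k 1) := by
    ext y
    have hd : ∀ i, DifferentiableAt ℝ (u i) y := fun i =>
      ((hu i).differentiable (by norm_num)).differentiableAt
    rw [fderiv_fun_sum (fun i _ => (hd i).const_mul (μ i))]
    simp [fderiv_const_mul (hd _)]
  rw [h1]
  have hd : ∀ i, DifferentiableAt ℝ (fun y => fderiv ℝ (u i) y (Pi.single k 1)) x := fun i =>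
      ((aux_pd1 (hu i) _).differentiable (by norm_num)).differentiableAt
  rw [fderiv_fun_sum (fun i _ => (hd i).const_mul (μ i))]
  simp [fderiv_const_mul (hd _)]

theorem aux_ibp {N : ℕ} {w φ : (Fin N → ℝ) → ℝ} (hw : ContDiff ℝ 2 w) (hφ : ContDiff ℝ 2 φ)
    (hc : HasCompactSupport φ) :
    ∫ x, laplacian w x * φ x = ∫ x, w x * laplacian φ x := by
  have key : ∀ i : Fin N,
      ∫ x, fderiv ℝ (fun y => fderiv ℝ w y (Pi.single i 1)) x (Pi.single i 1) * φ x
      = ∫ x, w x * fderiv ℝ (fun y => fderiv ℝ φ y (Pi.single i 1)) x (Pi.single i 1) := by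
    intro i
    have hw1 := aux_pd1 hw (Pi.single i 1)
    have hφ1 := aux_pd1 hφ (Pi.single i 1)
    have hw2 := aux_pd0 hw1 (Pi.single i 1)
    have hφ2 := aux_pd0 hφ1 (Pi.single i 1)
    have hc1 := hc.fderiv_apply ℝ (Pi.single i 1)
    have hc2 := hc1.fderiv_apply ℝ (Pi.single i 1)
    have I0 : Integrable (fun x => fderiv ℝ (fun y => fderiv ℝ w y (Pi.single i 1)) x (Pi.single i 1) * φ x) :=
      (hw2.mul hφ.continuous).integrable_of_hasCompactSupport hc.mul_left
    have I1 : Integrable (fun x => fderiv ℝ w x (Pi.single i 1) * fderiv ℝ φ x (Pi.single i 1)) :=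
      (hw1.continuous.mul hφ1.continuous).integrable_of_hasCompactSupport hc1.mul_left
    have I2 : Integrable (fun x => w x * fderiv ℝ (fun y => fderiv ℝ φ y (Pi.single i 1)) x (Pi.single i 1)) :=
      (hw.continuous.mul hφ2).integrable_of_hasCompactSupport hc2.mul_left
    have I3 : Integrable (fun x => fderiv ℝ w x (Pi.single i 1) * φ x) :=
      (hw1.continuous.mul hφ.continuous).integrable_of_hasCompactSupport hc.mul_left
    have I4 : Integrable (fun x => w x * fderiv ℝ φ x (Pi.single i 1)) :=
      (hw.continuous.mul hφ1.continuous).integrable_of_hasCompactSupport hc1.mul_left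
    have e1 := integral_mul_fderiv_eq_neg_fderiv_mul_of_integrable I0 I1 I3
      (fun x _ => (hw1.differentiable (by norm_num)).differentiableAt)
      (fun x _ => (hφ.differentiable (by norm_num)).differentiableAt)
    have e2 := integral_mul_fderiv_eq_neg_fderiv_mul_of_integrable I1 I2 I4
      (fun x _ => (hw.differentiable (by norm_num)).differentiableAt)
      (fun x _ => (hφ1.differentiable (by norm_num)).differentiableAt)
    linarith
  unfold laplacian
  simp_rw [Finset.sum_mul, Finset.mul_sum]
  rw [integral_finsetSum, integral_finsetSum]
  · exact Finset.sum_congr rfl fun i _ => key i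
  · intro i _
    exact (hw.continuous.mul (aux_pd0 (aux_pd1 hφ _) _)).integrable_of_hasCompactSupport
      ((hc.fderiv_apply ℝ _).fderiv_apply ℝ _).mul_left
  · intro i _
    exact ((aux_pd0 (aux_pd1 hw _) _).mul hφ.continuous).integrable_of_hasCompactSupport
      hc.mul_left

theorem aux_lap_smul {N : ℕ} (c : ℝ) (f : (Fin N → ℝ) → ℝ) (x : Fin N → ℝ) :
    laplacian (fun y => f (c • y)) x = c ^ 2 * laplacian f (c • x) := by
  unfold laplacian
  rw [Finset.mul_sum]
  refine Finset.sum_congr rfl fun i _ => ?_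
  have : (fun y => fderiv ℝ (fun y => f (c • y)) y (Pi.single i 1))
      = c • fun y => (fun z => fderiv ℝ f z (Pi.single i 1)) (c • y) := by
    ext y
    rw [fderiv_comp_smul]
    simp
  rw [this, fderiv_const_smul_field]
  have e := fderiv_comp_smul (𝕜 := ℝ) (f := fun z => fderiv ℝ f z (Pi.single i 1)) (x := x) c
  rw [Pi.smul_apply]
  simp only [ContinuousLinearMap.smul_apply, smul_eq_mul] at e ⊢
  rw [e]
  simp
  ring

theorem aux_lap_cube {N : ℕ} {g : (Fin N → ℝ) → ℝ} (hg : ContDiff ℝ 2 g) (hc : HasCompactSupport g)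
    (h0 : ∀ x, 0 ≤ g x) (h1 : ∀ x, g x ≤ 1) :
    ∃ C, 0 ≤ C ∧ ∀ x, |laplacian (fun y => g y ^ 3) x| ≤ C * g x := by
  have key : ∀ i : Fin N, ∃ C, 0 ≤ C ∧ ∀ x,
      |fderiv ℝ (fun y => fderiv ℝ (fun y => g y ^ 3) y (Pi.single i 1)) x (Pi.single i 1)|
        ≤ C * g x := by
    intro i
    have hg1 := aux_pd1 hg (Pi.single i 1)
    have hg2 := aux_pd0 hg1 (Pi.single i 1)
    have hc1 := hc.fderiv_apply ℝ (Pi.single i 1)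
    have hc2 := hc1.fderiv_apply ℝ (Pi.single i 1)
    obtain ⟨A, hA⟩ := hc1.exists_bound_of_continuous hg1.continuous
    obtain ⟨D, hD⟩ := hc2.exists_bound_of_continuous hg2
    have hA0 : 0 ≤ A := (norm_nonneg _).trans (hA 0)
    have hD0 : 0 ≤ D := (norm_nonneg _).trans (hD 0)
    refine ⟨6 * A ^ 2 + 3 * D, by positivity, fun x => ?_⟩
    have e1 : (fun y => fderiv ℝ (fun y => g y ^ 3) y (Pi.single i 1))
        = fun y => (3 * g y ^ 2) * fderiv ℝ g y (Pi.single i 1) := by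
      ext y
      have hd := ((hg.differentiable (by norm_num)) y).hasFDerivAt
      rw [(hd.pow 3).fderiv]
      simp
    rw [e1]
    have hd := ((hg.differentiable (by norm_num)) x).hasFDerivAt
    have hd1 := ((hg1.differentiable (by norm_num)) x).hasFDerivAt
    rw [(((hd.pow 2).const_mul 3).fun_mul hd1).fderiv]
    have hAx := hA x
    have hDx := hD x
    have h0x := h0 x
    have h1x := h1 x
    simp only [Real.norm_eq_abs] at hAx hDx
    simp
    generalize fderiv ℝ g x (Pi.single i 1) = p at *
    generalize (fderiv ℝ (fun y => fderiv ℝ g y (Pi.single i 1)) x) (Pi.single i 1) = q at *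
    have hp : p ^ 2 ≤ A ^ 2 := sq_le_sq' (abs_le.1 hAx).1 (abs_le.1 hAx).2
    have hq : |3 * g x ^ 2 * q| ≤ 3 * D * g x := by
      rw [abs_mul, abs_of_nonneg (by positivity)]
      calc 3 * g x ^ 2 * |q| ≤ 3 * g x * D := by
            apply mul_le_mul _ hDx (abs_nonneg _) (by positivity)
            nlinarith
        _ = _ := by ring
    calc _ = |3 * g x ^ 2 * q + 6 * g x * p ^ 2| := by congr 1; ring
      _ ≤ |3 * g x ^ 2 * q| + |6 * g x * p ^ 2| := abs_add_le _ _
      _ ≤ 3 * D * g x + 6 * g x * A ^ 2 := by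
          gcongr
          rw [abs_of_nonneg (by positivity)]
          gcongr
      _ = _ := by ring
  choose C hC0 hC using key
  refine ⟨∑ i, C i, Finset.sum_nonneg fun i _ => hC0 i, fun x => ?_⟩
  unfold laplacian
  rw [Finset.sum_mul]
  exact (Finset.abs_sum_le_sum_abs _ _).trans (Finset.sum_le_sum fun i _ => hC i x)

theorem aux_lap_const {N : ℕ} {f : (Fin N → ℝ) → ℝ} {c : ℝ} {x : Fin N → ℝ}
    (h : ∀ᶠ y in nhds x, f y = c) : laplacian f x = 0 := by
  unfold laplacian
  refine Finset.sum_eq_zero fun i _ => ?_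
  have : (fun y => fderiv ℝ f y (Pi.single i 1)) =ᶠ[nhds x] fun _ => 0 := by
    filter_upwards [h.eventually_nhds] with y hy
    have : f =ᶠ[nhds y] fun _ => c := hy
    rw [this.fderiv_eq]; simp
  rw [this.fderiv_eq]; simp

theorem aux_cutoff (N : ℕ) : ∃ C : ℝ, 0 ≤ C ∧ ∀ R : ℝ, 0 < R → ∃ η : (Fin N → ℝ) → ℝ,
    ContDiff ℝ 2 η ∧ HasCompactSupport η ∧ (∀ x, 0 ≤ η x) ∧ (∀ x, η x ≤ 1) ∧
    (∀ x ∈ ball 0 R, η x = 1) ∧ (∀ x, x ∉ ball 0 (2 * R) → η x = 0) ∧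
    (∀ x, |laplacian (fun y => η y ^ 3) x| ≤ C / R ^ 2 * η x) ∧
    (∀ x ∈ ball 0 R, laplacian (fun y => η y ^ 3) x = 0) := by
  let b : ContDiffBump (0 : Fin N → ℝ) := ⟨1, 2, by norm_num, by norm_num⟩
  obtain ⟨C, hC0, hC⟩ := aux_lap_cube (g := b) b.contDiff b.hasCompactSupport
    (fun x => b.nonneg) (fun x => b.le_one)
  refine ⟨C, hC0, fun R hR => ⟨fun x => b (R⁻¹ • x), ?_, ?_, fun x => b.nonneg, fun x => b.le_one,
    ?_, ?_, ?_, ?_⟩⟩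
  · exact b.contDiff.comp (contDiff_const_smul _)
  · exact b.hasCompactSupport.comp_smul (inv_ne_zero hR.ne')
  · intro x hx
    apply b.one_of_mem_closedBall
    simp only [mem_ball_zero_iff] at hx
    simp only [mem_closedBall_zero_iff, norm_smul, b, norm_inv, Real.norm_eq_abs, abs_of_pos hR]
    rw [inv_mul_le_iff₀ hR]; linarith
  · intro x hx
    apply b.zero_of_le_dist
    simp only [mem_ball_zero_iff, not_lt] at hx
    simp only [dist_zero_right, norm_smul, b, norm_inv, Real.norm_eq_abs, abs_of_pos hR]
    rw [le_inv_mul_iff₀ hR]; linarith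
  · intro x
    rw [aux_lap_smul R⁻¹ (fun y => b y ^ 3) x, abs_mul, abs_of_nonneg (by positivity)]
    calc _ ≤ R⁻¹ ^ 2 * (C * b (R⁻¹ • x)) := by gcongr; exact hC _
      _ = _ := by field_simp
  · intro x hx
    apply aux_lap_const (c := 1)
    filter_upwards [isOpen_ball.mem_nhds hx] with y hy
    simp only [mem_ball_zero_iff] at hy
    rw [b.one_of_mem_closedBall, one_pow]
    simp only [mem_closedBall_zero_iff, norm_smul, b, norm_inv, Real.norm_eq_abs, abs_of_pos hR]
    rw [inv_mul_le_iff₀ hR]; linarith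

theorem aux_young {a c t : ℝ} (ha : 0 < a) (hc : 0 ≤ c) (ht : 0 ≤ t) :
    c * t ≤ a * t ^ 3 + c * √(c / a) := by
  by_cases h : t ≤ √(c / a)
  · have : c * t ≤ c * √(c / a) := by gcongr
    have : 0 ≤ a * t ^ 3 := by positivity
    linarith
  · push Not at h
    have h2 := (Real.sqrt_lt' (lt_of_le_of_lt (Real.sqrt_nonneg _) h)).1 h
    rw [div_lt_iff₀ ha] at h2
    have : 0 ≤ c * √(c / a) := by positivity
    nlinarith

theorem aux_main {N : ℕ} (hN : N ≤ 3) {w : (Fin N → ℝ) → ℝ} (hw : ContDiff ℝ 2 w)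
    (hw0 : ∀ x, 0 ≤ w x) {κ : ℝ} (hκ : 0 < κ) (h : ∀ x, κ * w x ^ 3 ≤ -laplacian w x) :
    ∃ D : ℝ, 0 ≤ D ∧ ∀ R a : ℝ, 1 ≤ R → 0 < a →
      κ * (∫ x in ball 0 R, w x ^ 3) ≤
        a * ((∫ x in ball 0 (2 * R), w x ^ 3) - ∫ x in ball 0 R, w x ^ 3) + D / √a ∧
      (a < κ → (κ - a) * (∫ x in ball 0 R, w x ^ 3) ≤ D / √a) := by
  obtain ⟨C, hC0, hC⟩ := aux_cutoff N
  refine ⟨C * √C * 4 ^ N, by positivity, fun R a hR ha => ?_⟩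
  have hR0 : 0 < R := by linarith
  obtain ⟨η, h2, hcs, hp, hl, hone, hzero, hlap, hlap0⟩ := hC R hR0
  have hwi : ∀ r, IntegrableOn (fun x => w x ^ 3) (ball 0 r) := fun r =>
    ((hw.continuous.pow 3).continuousOn.integrableOn_compact
      (isCompact_closedBall 0 r)).mono_set ball_subset_closedBall
  have hcs3 : HasCompactSupport (fun x => η x ^ 3) :=
    hcs.comp_left (g := fun t : ℝ => t ^ 3) (by norm_num)
  have h23 : ContDiff ℝ 2 (fun x => η x ^ 3) := h2.pow 3
  have hPi : Integrable (fun x => w x ^ 3 * η x ^ 3) :=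
    ((hw.continuous.pow 3).mul h23.continuous).integrable_of_hasCompactSupport hcs3.mul_left
  have hLi : Integrable (fun x => laplacian w x * η x ^ 3) :=
    ((aux_lap_cont hw).mul h23.continuous).integrable_of_hasCompactSupport hcs3.mul_left
  set A : Set (Fin N → ℝ) := ball 0 (2 * R) \ ball 0 R with hA
  have hsub : ball (0 : Fin N → ℝ) R ⊆ ball 0 (2 * R) := ball_subset_ball (by linarith)
  have hAm : MeasurableSet A := measurableSet_ball.diff measurableSet_ball
  have hvol : volume.real A ≤ (4 * R) ^ N := by
    have e : volume.real (ball (0 : Fin N → ℝ) (2 * R)) = (4 * R) ^ N := by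
      rw [Measure.real, Real.volume_pi_ball _ (by positivity), ENNReal.toReal_ofReal (by positivity)]
      simp; ring
    rw [← e]
    exact measureReal_mono Set.sdiff_subset measure_ball_lt_top.ne
  have hAfin : volume A ≠ ⊤ :=
    ((measure_mono Set.sdiff_subset).trans_lt (measure_ball_lt_top (x := (0 : Fin N → ℝ)) (r := 2 * R))).ne
  set c := C / R ^ 2 with hc
  have hc0 : 0 ≤ c := by positivity
  -- step 1
  have s1 : κ * ∫ x, w x ^ 3 * η x ^ 3 ≤ - ∫ x, w x * laplacian (fun y => η y ^ 3) x := by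
    rw [← aux_ibp hw h23 hcs3, ← integral_neg, ← integral_const_mul]
    apply integral_mono (hPi.const_mul κ) hLi.neg
    intro x
    have := mul_le_mul_of_nonneg_right (h x) (pow_nonneg (hp x) 3)
    simp only [Pi.neg_apply]
    linarith
  have s2 : - ∫ x, w x * laplacian (fun y => η y ^ 3) x ≤
      ∫ x in A, (a * (w x ^ 3 * η x ^ 3) + c * √(c / a)) := by
    rw [← integral_neg, ← integral_indicator hAm]
    have hz : HasCompactSupport (laplacian (fun y => η y ^ 3)) := by
      refine HasCompactSupport.of_support_subset_isCompact hcs.isCompact ?_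
      intro x hx
      by_contra hx'
      apply hx
      have : η x = 0 := image_eq_zero_of_notMem_tsupport hx'
      have := hlap x
      simp_all
    apply integral_mono
    · exact (((hw.continuous.mul (aux_lap_cont h23)).integrable_of_hasCompactSupport
        hz.mul_left)).neg
    · rw [integrable_indicator_iff hAm]
      exact (hPi.const_mul a).integrableOn.add (integrableOn_const hAfin)
    intro x
    by_cases hx : x ∈ A
    · rw [Set.indicator_of_mem hx]
      have y := aux_young ha hc0 (mul_nonneg (hw0 x) (hp x))
      have l := mul_le_mul_of_nonneg_left ((neg_le_abs _).trans (hlap x)) (hw0 x)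
      rw [mul_pow] at y
      simp only
      linarith
    · rw [Set.indicator_of_notMem hx]
      have : laplacian (fun y => η y ^ 3) x = 0 := by
        by_cases hx1 : x ∈ ball 0 R
        · exact hlap0 x hx1
        · have : η x = 0 := hzero x fun hx2 => hx ⟨hx2, hx1⟩
          have := hlap x
          simp_all
      simp [this]
  have s3 : ∫ x in A, (a * (w x ^ 3 * η x ^ 3) + c * √(c / a)) ≤
      a * (∫ x in A, w x ^ 3 * η x ^ 3) + C * √C * 4 ^ N / √a := by
    rw [integral_add (hPi.const_mul a).integrableOn (integrableOn_const hAfin), integral_const_mul]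
    gcongr
    rw [setIntegral_const, smul_eq_mul]
    calc volume.real A * (c * √(c / a)) ≤ (4 * R) ^ N * (c * √(c / a)) := by gcongr
      _ = C * √C * 4 ^ N / √a * (R ^ N / R ^ 3) := by
        rw [hc, Real.sqrt_div (by positivity), Real.sqrt_div hC0, Real.sqrt_sq hR0.le, mul_pow]
        field_simp
      _ ≤ C * √C * 4 ^ N / √a * 1 := by
        gcongr
        rw [div_le_one (by positivity)]
        exact pow_le_pow_right₀ hR hN
      _ = _ := mul_one _
  have hnn : ∀ x, 0 ≤ w x ^ 3 * η x ^ 3 := fun x =>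
    mul_nonneg (pow_nonneg (hw0 x) 3) (pow_nonneg (hp x) 3)
  have t1 : ∫ x in ball 0 R, w x ^ 3 ≤ ∫ x, w x ^ 3 * η x ^ 3 := by
    calc ∫ x in ball 0 R, w x ^ 3 = ∫ x in ball 0 R, w x ^ 3 * η x ^ 3 :=
          setIntegral_congr_fun measurableSet_ball fun x hx => by simp [hone x hx]
      _ ≤ _ := setIntegral_le_integral hPi (Filter.Eventually.of_forall hnn)
  have t2 : ∫ x in A, w x ^ 3 * η x ^ 3 ≤ ∫ x, w x ^ 3 * η x ^ 3 :=
    setIntegral_le_integral hPi (Filter.Eventually.of_forall hnn)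
  have t3 : ∫ x in A, w x ^ 3 * η x ^ 3 ≤
      (∫ x in ball 0 (2 * R), w x ^ 3) - ∫ x in ball 0 R, w x ^ 3 := by
    rw [← setIntegral_sdiff measurableSet_ball (hwi _) hsub]
    apply setIntegral_mono hPi.integrableOn ((hwi _).mono_set Set.sdiff_subset)
    intro x
    exact mul_le_of_le_one_right (pow_nonneg (hw0 x) 3) (pow_le_one₀ (hp x) (hl x))
  constructor
  · have := mul_le_mul_of_nonneg_left t1 hκ.le
    have := mul_le_mul_of_nonneg_left t3 ha.le
    linarith
  · intro hak
    have := mul_le_mul_of_nonneg_left t1 (sub_pos.2 hak).le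
    have := mul_le_mul_of_nonneg_left t2 ha.le
    linarith

theorem aux_abstract {J : ℝ → ℝ} {κ D : ℝ} (hκ : 0 < κ) (hD : 0 ≤ D)
    (h : ∀ R a : ℝ, 1 ≤ R → 0 < a → κ * J R ≤ a * (J (2 * R) - J R) + D / √a ∧
      (a < κ → (κ - a) * J R ≤ D / √a)) : ∀ R, 1 ≤ R → J R ≤ 0 := by
  have hb : BddAbove (J '' Set.Ici 1) := by
    refine ⟨D / √(κ / 2) / (κ / 2), ?_⟩
    rintro _ ⟨R, hR, rfl⟩
    rw [le_div_iff₀ (by positivity)]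
    have := (h R (κ / 2) hR (by positivity)).2 (by linarith)
    linarith
  set L := sSup (J '' Set.Ici 1) with hL
  have hle : ∀ R, 1 ≤ R → J R ≤ L := fun R hR => le_csSup hb ⟨R, hR, rfl⟩
  suffices L ≤ 0 from fun R hR => (hle R hR).trans this
  by_contra hLp
  push Not at hLp
  set s := 4 * D / (κ * L) + 1 with hs
  have hs0 : 0 < s := by positivity
  have hDs : D / s ≤ κ * L / 4 := by
    rw [div_le_iff₀ hs0, hs]
    have : κ * L / 4 * (4 * D / (κ * L) + 1) = D + κ * L / 4 := by field_simp
    rw [this]; have : 0 < κ * L := by positivity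
    linarith
  set ε := min (L / 4) (κ * L / (4 * s ^ 2)) with hε
  have hε0 : 0 < ε := lt_min (by positivity) (by positivity)
  have e1 : ε ≤ L / 4 := min_le_left _ _
  have e2 : s ^ 2 * ε ≤ κ * L / 4 := by
    calc s ^ 2 * ε ≤ s ^ 2 * (κ * L / (4 * s ^ 2)) := by gcongr; exact min_le_right _ _
      _ = _ := by field_simp
  obtain ⟨_, ⟨R, hR, rfl⟩, hRL⟩ := exists_lt_of_lt_csSup (s := J '' Set.Ici 1)
    ⟨J 1, 1, by simp, rfl⟩ (show L - ε < sSup (J '' Set.Ici 1) by linarith)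
  have hR1 : (1 : ℝ) ≤ R := hR
  have k := (h R (s ^ 2) hR1 (by positivity)).1
  rw [Real.sqrt_sq hs0.le] at k
  have h2R := hle (2 * R) (by linarith)
  have k2 : s ^ 2 * (J (2 * R) - J R) ≤ s ^ 2 * ε := by gcongr; linarith
  have k3 : κ * (L - L / 4) ≤ κ * J R := by gcongr; linarith
  have : 0 < κ * L := by positivity
  linarith

theorem aux_liouville {N : ℕ} (hN : N ≤ 3) {w : (Fin N → ℝ) → ℝ} (hw : ContDiff ℝ 2 w)
    (hw0 : ∀ x, 0 ≤ w x) {κ : ℝ} (hκ : 0 < κ) (h : ∀ x, κ * w x ^ 3 ≤ -laplacian w x) :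
    ∀ x, w x = 0 := by
  obtain ⟨D, hD, hm⟩ := aux_main hN hw hw0 hκ h
  have hJ := aux_abstract (J := fun R => ∫ x in ball 0 R, w x ^ 3) hκ hD hm
  intro x
  have hR := hJ (‖x‖ + 1) (by linarith [norm_nonneg x])
  have hi : IntegrableOn (fun x => w x ^ 3) (ball 0 (‖x‖ + 1)) :=
    ((hw.continuous.pow 3).continuousOn.integrableOn_compact
      (isCompact_closedBall 0 _)).mono_set ball_subset_closedBall
  have h0 : ∫ x in ball 0 (‖x‖ + 1), w x ^ 3 = 0 :=
    le_antisymm hR (integral_nonneg fun x => pow_nonneg (hw0 x) 3)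
  rw [integral_eq_zero_iff_of_nonneg (fun x => pow_nonneg (hw0 x) 3) hi] at h0
  have := Measure.eqOn_open_of_ae_eq h0 isOpen_ball (hw.continuous.pow 3).continuousOn
    continuousOn_const
  have := this (show x ∈ ball 0 (‖x‖ + 1) by simp)
  simpa using this

theorem aux_copos {n : ℕ} (B : Matrix (Fin n) (Fin n) ℝ) (μ : Fin n → ℝ) (hμ : ∀ i, 0 ≤ μ i)
    (h : ∀ c : Fin n → ℝ, (∀ i, 0 ≤ c i) → c ≠ 0 → 0 < ∑ i, ∑ j, B i j * c j ^ 2 * c i * μ i) :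
    ∃ κ : ℝ, 0 < κ ∧ ∀ c : Fin n → ℝ, (∀ i, 0 ≤ c i) →
      κ * (∑ i, μ i * c i) ^ 3 ≤ ∑ i, ∑ j, B i j * c j ^ 2 * c i * μ i := by
  set F : (Fin n → ℝ) → ℝ := fun c => ∑ i, ∑ j, B i j * c j ^ 2 * c i * μ i with hF
  have hFc : Continuous F := by fun_prop
  have hcomp : IsCompact (sphere (0 : Fin n → ℝ) 1 ∩ Set.Ici 0) :=
    (isCompact_sphere 0 1).inter_right isClosed_Ici
  obtain ⟨m, hm, hmF⟩ : ∃ m : ℝ, 0 < m ∧ ∀ c ∈ sphere (0 : Fin n → ℝ) 1 ∩ Set.Ici 0, m ≤ F c := by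
    rcases (sphere (0 : Fin n → ℝ) 1 ∩ Set.Ici 0).eq_empty_or_nonempty with he | hne
    · exact ⟨1, one_pos, fun c hc => by rw [he] at hc; exact hc.elim⟩
    · obtain ⟨c, hc, hmin⟩ := hcomp.exists_isMinOn hne hFc.continuousOn
      refine ⟨F c, h c (fun i => hc.2 i) ?_, fun d hd => hmin hd⟩
      rintro rfl
      simpa using hc.1
  set S := ∑ i, μ i with hS
  have hS0 : 0 ≤ S := Finset.sum_nonneg fun i _ => hμ i
  refine ⟨m / (S + 1) ^ 3, by positivity, fun c hc => ?_⟩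
  by_cases hc0 : c = 0
  · subst hc0; simp
  have hn : 0 < ‖c‖ := norm_pos_iff.2 hc0
  have e1 : F c = ‖c‖ ^ 3 * F (‖c‖⁻¹ • c) := by
    simp only [hF, Finset.mul_sum, Pi.smul_apply, smul_eq_mul]
    refine Finset.sum_congr rfl fun i _ => Finset.sum_congr rfl fun j _ => ?_
    field_simp
  have e2 : m ≤ F (‖c‖⁻¹ • c) := by
    apply hmF
    refine ⟨?_, fun i => ?_⟩
    · simp [norm_smul, hn.ne']
    · have := hc i
      simp only [Pi.zero_apply, Pi.smul_apply, smul_eq_mul]; positivity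
  have e3 : ∑ i, μ i * c i ≤ (S + 1) * ‖c‖ := by
    calc ∑ i, μ i * c i ≤ ∑ i, μ i * ‖c‖ := by
          gcongr with i _
          · exact hμ i
          · exact (le_abs_self _).trans (norm_le_pi_norm c i)
      _ = S * ‖c‖ := by rw [hS, Finset.sum_mul]
      _ ≤ _ := by nlinarith
  have e4 : 0 ≤ ∑ i, μ i * c i := Finset.sum_nonneg fun i _ => mul_nonneg (hμ i) (hc i)
  calc m / (S + 1) ^ 3 * (∑ i, μ i * c i) ^ 3 ≤ m / (S + 1) ^ 3 * ((S + 1) * ‖c‖) ^ 3 := by gcongr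
    _ = ‖c‖ ^ 3 * m := by field_simp
    _ ≤ ‖c‖ ^ 3 * F (‖c‖⁻¹ • c) := by gcongr
    _ = F c := e1.symm

theorem stmt_1 (N n : ℕ) (hN1 : 1 ≤ N) (hN : N ≤ 3)
    (B : Matrix (Fin n) (Fin n) ℝ) (hsym : B.IsSymm)
    (hscc : (∃ μ : Fin n → ℝ, (∀ i, 0 ≤ μ i) ∧ ∀ c : Fin n → ℝ, (∀ i, 0 ≤ c i) → c ≠ 0 → 0 < ∑ i, ∑ j, B i j * c j ^ 2 * c i * μ i))
    (u : Fin n → (Fin N → ℝ) → ℝ)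
    (hreg : ∀ i, ContDiff ℝ 2 (u i))
    (hpos : ∀ i x, 0 ≤ u i x)
    (heq : ∀ i x, -laplacian (u i) x = ∑ j, B i j * (u j x) ^ 2 * u i x) :
    ∀ i, u i = 0 := by
  obtain ⟨μ, hμ, hB⟩ := hscc
  obtain ⟨κ, hκ, hk⟩ := aux_copos B μ hμ hB
  have hlap : ∀ x, -laplacian (fun x => ∑ i, μ i * u i x) x
      = ∑ i, ∑ j, B i j * (u j x) ^ 2 * u i x * μ i := by
    intro x
    rw [aux_lap_sum μ u hreg, ← Finset.sum_neg_distrib]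
    refine Finset.sum_congr rfl fun i _ => ?_
    rw [← Finset.sum_mul, ← heq]; ring
  have hw : ContDiff ℝ 2 (fun x => ∑ i, μ i * u i x) :=
    ContDiff.sum fun i _ => contDiff_const.mul (hreg i)
  have hz := aux_liouville hN hw
    (fun x => Finset.sum_nonneg fun i _ => mul_nonneg (hμ i) (hpos i x)) hκ
    (fun x => by rw [hlap]; exact hk (fun i => u i x) fun i => hpos i x)
  intro i
  ext x
  by_contra hne
  have hp := hB (fun i => u i x) (fun i => hpos i x) (fun h => hne (congrFun h i))
  rw [← hlap x, aux_lap_const (c := 0) (Filter.Eventually.of_forall hz)] at hp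
  simp at hp
end

section
/- Let B = (β_ij) be a symmetric n×n real matrix. If B is strictly cubically copositive, then B is strictly copositive. -/
open Finset

theorem stmt_2 (n : ℕ) (B : Matrix (Fin n) (Fin n) ℝ) (hsym : B.IsSymm)
    (hscc : (∃ μ : Fin n → ℝ, (∀ i, 0 ≤ μ i) ∧ ∀ c : Fin n → ℝ, (∀ i, 0 ≤ c i) → c ≠ 0 → 0 < ∑ i, ∑ j, B i j * c j ^ 2 * c i * μ i)) :
    (∀ c : Fin n → ℝ, (∀ i, 0 ≤ c i) → c ≠ 0 → 0 < ∑ i, ∑ j, B i j * c i * c j) := by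
  obtain ⟨μ, hμ, H⟩ := hscc
  intro c hc hc0
  by_contra hneg
  have hneg := not_lt.mp hneg
  let f : (Fin n → ℝ) → ℝ := fun y => ∑ i, ∑ j, B i j * y i * y j
  have hfc : f c ≤ 0 := hneg
  have hf0 : f 0 = 0 := by simp [f]
  have hcont : Continuous f := by fun_prop
  have hcI : c ∈ Set.Icc 0 c := ⟨hc, le_refl c⟩
  have hmin : ∃ x ∈ Set.Icc 0 c, x ≠ 0 ∧ ∀ y ∈ Set.Icc 0 c, f x ≤ f y := by
    obtain ⟨x, hx, hxm⟩ := (isCompact_Icc (a := (0 : Fin n → ℝ)) (b := c)).exists_isMinOn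
      ⟨c, hcI⟩ hcont.continuousOn
    by_cases h : x = 0
    · refine ⟨c, hcI, hc0, fun y hy => ?_⟩
      have h1 : f x ≤ f y := hxm hy
      rw [h, hf0] at h1
      exact hfc.trans h1
    · exact ⟨x, hx, h, fun y hy => hxm hy⟩
  obtain ⟨x, hx, hx0, hxm⟩ := hmin
  have key : ∀ i, 0 < x i → ∑ j, B i j * x j ≤ 0 := by
    intro i hi
    have hexp : ∀ t : ℝ, f (x - t • Pi.single i 1) =
        f x - 2 * t * (∑ j, B i j * x j) + t ^ 2 * B i i := by
      intro t
      have hf : ∀ y, f y = y ⬝ᵥ (B.mulVec y) := by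
        intro y
        simp only [f, dotProduct, Matrix.mulVec, Finset.mul_sum]
        exact Finset.sum_congr rfl fun a _ => Finset.sum_congr rfl fun b _ => by ring
      have h1 : (Pi.single i 1 : Fin n → ℝ) ⬝ᵥ (B.mulVec x) = ∑ j, B i j * x j := by
        simp [Matrix.mulVec, dotProduct, Pi.single_apply]
      have h2 : x ⬝ᵥ (B.mulVec (Pi.single i 1)) = ∑ j, B i j * x j := by
        simp only [Matrix.mulVec_single_one, dotProduct, Matrix.col_apply]
        exact Finset.sum_congr rfl fun a _ => by rw [hsym.apply i a]; ring
      have h3 : (Pi.single i 1 : Fin n → ℝ) ⬝ᵥ (B.mulVec (Pi.single i 1)) = B i i := by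
        simp
      rw [hf, hf, Matrix.mulVec_sub, Matrix.mulVec_smul]
      simp only [sub_dotProduct, dotProduct_sub, smul_dotProduct, dotProduct_smul, h1, h2, h3,
        smul_eq_mul]
      ring
    by_contra hp
    have hp := not_le.mp hp
    set p := ∑ j, B i j * x j with hpdef
    have hD : 0 < |B i i| + 1 := by positivity
    obtain ⟨t, ht0, htx, htp⟩ : ∃ t : ℝ, 0 < t ∧ t ≤ x i ∧ t * (|B i i| + 1) ≤ p := by
      refine ⟨min (x i) (p / (|B i i| + 1)), by positivity, min_le_left _ _, ?_⟩
      exact (le_div_iff₀ hD).mp (min_le_right _ _)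
    have hmem : x - t • Pi.single i 1 ∈ Set.Icc 0 c := by
      constructor
      · intro j
        by_cases hj : j = i
        · subst hj; simpa using htx
        · simpa [hj] using hx.1 j
      · intro j
        by_cases hj : j = i
        · subst hj
          have := hx.2 j
          simp; linarith
        · simpa [hj] using hx.2 j
    have h := hxm _ hmem
    rw [hexp] at h
    have h4 := le_abs_self (B i i)
    have h5 : t * B i i ≤ p := by nlinarith
    nlinarith [mul_le_mul_of_nonneg_left h5 ht0.le, mul_pos ht0 hp]
  have hpos := H (fun i => √(x i)) (fun i => Real.sqrt_nonneg _) (by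
    intro h
    apply hx0
    funext i
    have := congrFun h i
    exact (Real.sqrt_eq_zero (hx.1 i)).mp this)
  refine absurd hpos (not_lt.mpr ?_)
  apply Finset.sum_nonpos
  intro i _
  have he : ∑ j, B i j * √(x j) ^ 2 * √(x i) * μ i = (∑ j, B i j * x j) * (√(x i) * μ i) := by
    rw [Finset.sum_mul]
    exact Finset.sum_congr rfl fun j _ => by rw [Real.sq_sqrt (hx.1 j)]; ring
  rw [he]
  rcases (hx.1 i).eq_or_lt with h | h
  · have : x i = 0 := h.symm
    simp [this]
  · exact mul_nonpos_of_nonpos_of_nonneg (key i h) (mul_nonneg (Real.sqrt_nonneg _) (hμ i))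
end

section
/- Let B = (β_ij) be a symmetric 2×2 real matrix. If B is strictly copositive, then B is strictly cubically copositive; in fact the vector μ = (β₁₁^{−1/4}, β₂₂^{−1/4}) satisfies ∑_{i,j=1}^2 β_ij c_j² c_i μ_i > 0 for every c ∈ C⁺₂ with c ≠ 0. -/
open Finset

lemma root_aux (a : ℝ) (ha : 0 < a) : ∃ p : ℝ, 0 < p ∧ a = p ^ 4 ∧ a ^ (-(1 / 4) : ℝ) = p⁻¹ := by
  refine ⟨a ^ ((1 / 4) : ℝ), Real.rpow_pos_of_pos ha _, ?_, Real.rpow_neg ha.le _⟩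
  rw [← Real.rpow_natCast, ← Real.rpow_mul ha.le]
  norm_num

lemma main_aux (p q b x y : ℝ) (hp : 0 < p) (hq : 0 < q) (hb : 0 < b + p ^ 2 * q ^ 2)
    (hx : 0 ≤ x) (hy : 0 ≤ y) (h : x ≠ 0 ∨ y ≠ 0) :
    0 < p ^ 4 * x ^ 2 * x * p⁻¹ + b * y ^ 2 * x * p⁻¹
      + (b * x ^ 2 * y * q⁻¹ + q ^ 4 * y ^ 2 * y * q⁻¹) := by
  have e : p ^ 4 * x ^ 2 * x * p⁻¹ + b * y ^ 2 * x * p⁻¹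
      + (b * x ^ 2 * y * q⁻¹ + q ^ 4 * y ^ 2 * y * q⁻¹)
      = (p * x + q * y) * (p * q * (p * x - q * y) ^ 2 + (b + p ^ 2 * q ^ 2) * (x * y)) / (p * q) := by
    field_simp
    ring
  rw [e]
  apply div_pos _ (by positivity)
  rcases hx.eq_or_lt with rfl | hx'
  · have hy' : 0 < y := lt_of_le_of_ne hy (by rintro rfl; simp at h)
    have : 0 < (q * y) ^ 2 := by positivity
    simp only [mul_zero, zero_mul, zero_add, add_zero, zero_sub, neg_sq]
    positivity
  · rcases hy.eq_or_lt with rfl | hy'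
    · simp only [mul_zero, add_zero, sub_zero]
      positivity
    · positivity

theorem stmt_3 (B : Matrix (Fin 2) (Fin 2) ℝ) (hsym : B.IsSymm)
    (hcop : ∀ c : Fin 2 → ℝ, (∀ i, 0 ≤ c i) → c ≠ 0 →
      0 < ∑ i, ∑ j, B i j * c i * c j) :
    (∃ μ : Fin 2 → ℝ, (∀ i, 0 ≤ μ i) ∧ ∀ c : Fin 2 → ℝ, (∀ i, 0 ≤ c i) → c ≠ 0 → 0 < ∑ i, ∑ j, B i j * c j ^ 2 * c i * μ i) ∧
    (∀ c : Fin 2 → ℝ, (∀ i, 0 ≤ c i) → c ≠ 0 →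
      0 < ∑ i, ∑ j, B i j * c j ^ 2 * c i * (![B 0 0 ^ (-(1 / 4) : ℝ), B 1 1 ^ (-(1 / 4) : ℝ)] i)) := by
  have h0 := hcop ![1, 0] (by intro i; fin_cases i <;> simp) (by intro h; simpa using congrFun h 0)
  have h1 := hcop ![0, 1] (by intro i; fin_cases i <;> simp) (by intro h; simpa using congrFun h 1)
  simp [Fin.sum_univ_two] at h0 h1
  obtain ⟨p, hp, hp4, hpi⟩ := root_aux _ h0
  obtain ⟨q, hq, hq4, hqi⟩ := root_aux _ h1
  have hs : B 1 0 = B 0 1 := hsym.apply 0 1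
  have hb : 0 < B 0 1 + p ^ 2 * q ^ 2 := by
    have h2 := hcop ![q ^ 2, p ^ 2] (by intro i; fin_cases i <;> simp <;> positivity)
      (by intro h; have := congrFun h 0; simp at this; exact hq.ne' this)
    simp [Fin.sum_univ_two, hs, hp4, hq4] at h2
    have h3 : 0 < (2 * (p ^ 2 * q ^ 2)) * (B 0 1 + p ^ 2 * q ^ 2) := by nlinarith [h2]
    exact pos_of_mul_pos_right h3 (by positivity)
  have key : ∀ c : Fin 2 → ℝ, (∀ i, 0 ≤ c i) → c ≠ 0 →
      0 < ∑ i, ∑ j, B i j * c j ^ 2 * c i * (![B 0 0 ^ (-(1 / 4) : ℝ), B 1 1 ^ (-(1 / 4) : ℝ)] i) := by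
    intro c hc hne
    rw [hpi, hqi]
    simp only [Fin.sum_univ_two, hs, hp4, hq4, Matrix.cons_val_zero, Matrix.cons_val_one]
    refine main_aux p q (B 0 1) (c 0) (c 1) hp hq hb (hc 0) (hc 1) ?_
    by_contra hcon
    push Not at hcon
    apply hne
    funext i
    fin_cases i
    · exact hcon.1
    · exact hcon.2
  refine ⟨⟨_, ?_, key⟩, key⟩
  rw [hpi, hqi]
  intro i
  fin_cases i
  · simpa using hp.le
  · simpa using hq.le
end
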